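/- Consider the nonlinear continuous-time delayed algorithm in ℝ^m with couplings φ_ij(y,z) = ψ_ij(y,z)·(y − z), where each ψ_ij : ℝ^m × ℝ^m → ℝ is continuous and for every compact set Ω ⊂ ℝ^m × ℝ^m satisfies 0 < inf_{(y,z)∈Ω} ψ_ij(y,z) ≤ sup_{(y,z)∈Ω} ψ_ij(y,z) < ∞. If the weights a_ij satisfy the uniform local integrability assumption and the matrix function A(·) is aperiodically quasi-strongly connected (AQSC), then for every delay bound h̄ ≥ 0 and all measurable delays h_ij(t) ∈ [0,h̄], every solution from every starting time converges to a common limit in ℝ^m (global consensus). If instead A(·) has the non-instantaneous type-symmetry (NITS) property and satisfies the uniform local integrability assumption, then every solution converges, and the limits of x_i and x_j coincide for every solution whenever i and j lie in the same connected component of the persistent graph G∞. -/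

import Mathlib

open MeasureTheory Filter Topology Set

/-- There is a root node connected to every node by a directed walk. -/
def QSCrel {α : Type*} (r : α → α → Prop) : Prop :=
  ∃ root : α, ∀ i : α, Relation.ReflTransGen r root i

/-- The graph of the nonnegative matrix `B` (arc `(j,i)` iff `B i j > 0`), with all
entries smaller than `ε` zeroed out, is quasi-strongly connected. -/
def QSCeps {V : Type*} (ε : ℝ) (B : V → V → ℝ) : Prop :=
  QSCrel (fun u v : V => ε ≤ B v u)

variable {V : Type*} [Fintype V] [DecidableEq V]

/-- An increasing sequence of times tending to infinity, starting in `[0,∞)`. -/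
def IncrSeq (tp : ℕ → ℝ) : Prop :=
  StrictMono tp ∧ Tendsto tp atTop atTop ∧ 0 ≤ tp 0

/-- `(t_p)`-boundedness of the matrix function `A(⬝) = (a i j ⬝)`. -/
def tpBounded (a : V → V → ℝ → ℝ) (tp : ℕ → ℝ) : Prop :=
  ∃ L : ℝ, ∀ p : ℕ, ∀ i j : V, i ≠ j → (∫ s in (tp p)..(tp (p+1)), a i j s) ≤ L

/-- Aperiodic quasi-strong connectivity. -/
def AQSC (a : V → V → ℝ → ℝ) : Prop :=
  ∃ ε > (0:ℝ), ∃ tp : ℕ → ℝ, IncrSeq tp ∧ tpBounded a tp ∧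
    ∀ p : ℕ, QSCeps ε (fun i j => ∫ s in (tp p)..(tp (p+1)), a i j s)

/-- Non-instantaneous type-symmetry. -/
def NITS (a : V → V → ℝ → ℝ) : Prop :=
  ∃ K ≥ (1:ℝ), ∃ tp : ℕ → ℝ, IncrSeq tp ∧ tpBounded a tp ∧
    ∀ p : ℕ, ∀ i j : V,
      (1/K) * (∫ s in (tp p)..(tp (p+1)), a j i s) ≤ (∫ s in (tp p)..(tp (p+1)), a i j s) ∧
      (∫ s in (tp p)..(tp (p+1)), a i j s) ≤ K * (∫ s in (tp p)..(tp (p+1)), a j i s)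

/-- Uniform local integrability of the weights. -/
def ULI (a : V → V → ℝ → ℝ) : Prop :=
  ∀ D > (0:ℝ), ∃ M : ℝ, ∀ t ≥ (0:ℝ), ∀ i j : V, i ≠ j → (∫ s in t..(t+D), a i j s) ≤ M

/-- Admissible weights: measurable, nonnegative, locally integrable. -/
def Weights (a : V → V → ℝ → ℝ) : Prop :=
  ∀ i j : V, i ≠ j → Measurable (a i j) ∧ (∀ t ≥ (0:ℝ), 0 ≤ a i j t) ∧
    ∀ T : ℝ, IntegrableOn (a i j) (Icc 0 T)

/-- Admissible delays: measurable with values in `[0, h̄]`. -/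
def Delays (h : V → V → ℝ → ℝ) (hbar : ℝ) : Prop :=
  ∀ i j : V, Measurable (h i j) ∧ ∀ t ≥ (0:ℝ), h i j t ∈ Icc (0:ℝ) hbar

/-- Right-hand side of the delayed averaging dynamics. -/
def rhs (a h : V → V → ℝ → ℝ) (x : ℝ → V → ℝ) (i : V) (s : ℝ) : ℝ :=
  ∑ j ∈ Finset.univ.erase i, a i j s * (x (s - h i j s) j - x s i)

/-- A solution of the continuous-time delayed averaging algorithm with starting time `tstar`. -/
def IsSol (a h : V → V → ℝ → ℝ) (hbar tstar : ℝ) (x : ℝ → V → ℝ) : Prop :=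
  (∀ i : V, AEStronglyMeasurable (fun s => x s i) (volume.restrict (Icc (tstar - hbar) tstar))) ∧
  (∃ M : ℝ, ∀ s ∈ Icc (tstar - hbar) tstar, ∀ i : V, |x s i| ≤ M) ∧
  ∀ i : V, ∀ t ≥ tstar,
    IntervalIntegrable (rhs a h x i) volume tstar t ∧
    x t i = x tstar i + ∫ s in tstar..t, rhs a h x i s

/-- `Λ(t)`: supremum of the values over the window `[t-h̄, t]`. -/
noncomputable def Lam (hbar : ℝ) (x : ℝ → V → ℝ) (t : ℝ) : ℝ :=
  sSup {v | ∃ s ∈ Icc (t - hbar) t, ∃ i : V, x s i = v}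

/-- `λ(t)`: infimum of the values over the window `[t-h̄, t]`. -/
noncomputable def lam (hbar : ℝ) (x : ℝ → V → ℝ) (t : ℝ) : ℝ :=
  sInf {v | ∃ s ∈ Icc (t - hbar) t, ∃ i : V, x s i = v}

/-- Arc `(j,i)` of the persistent graph: `∫₀^∞ a i j = ∞`. -/
def PArc (a : V → V → ℝ → ℝ) (j i : V) : Prop :=
  j ≠ i ∧ (∫⁻ t in Ioi (0:ℝ), ENNReal.ofReal (a i j t)) = ⊤

/-- `i` and `j` are joined by a walk in the persistent graph. -/
def JoinedG (a : V → V → ℝ → ℝ) (i j : V) : Prop :=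
  Relation.ReflTransGen (fun u v => PArc a u v) i j

/-- Right-hand side of the nonlinear delayed averaging dynamics in `ℝ^m`. -/
def rhsN (m : ℕ) (a h : V → V → ℝ → ℝ)
    (ψ : V → V → (Fin m → ℝ) → (Fin m → ℝ) → ℝ)
    (x : ℝ → V → (Fin m → ℝ)) (i : V) (s : ℝ) : Fin m → ℝ :=
  ∑ j ∈ Finset.univ.erase i,
    (a i j s * ψ i j (x (s - h i j s) j) (x s i)) • (x (s - h i j s) j - x s i)

/-- A solution of the nonlinear continuous-time delayed algorithm. -/
def IsSolN (m : ℕ) (a h : V → V → ℝ → ℝ)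
    (ψ : V → V → (Fin m → ℝ) → (Fin m → ℝ) → ℝ)
    (hbar tstar : ℝ) (x : ℝ → V → (Fin m → ℝ)) : Prop :=
  (∀ i : V, AEStronglyMeasurable (fun s => x s i) (volume.restrict (Icc (tstar - hbar) tstar))) ∧
  (∃ M : ℝ, ∀ s ∈ Icc (tstar - hbar) tstar, ∀ i : V, ‖x s i‖ ≤ M) ∧
  ∀ i : V, ∀ t ≥ tstar,
    IntervalIntegrable (rhsN m a h ψ x i) volume tstar t ∧
    x t i = x tstar i + ∫ s in tstar..t, rhsN m a h ψ x i s


lemma aux_exp_ac {q : ℝ → ℝ} (hq : ∀ a b, IntervalIntegrable q volume a b)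
    (hq0 : ∀ s, 0 ≤ q s) {t0 t : ℝ} (ht : t0 ≤ t) :
    AbsolutelyContinuousOnInterval (fun r => Real.exp (-∫ s in t0..r, q s)) t0 t := by
  have h1 := (hq t0 t).absolutelyContinuousOnInterval_intervalIntegral (c := t0)
    (by simp [ht])
  rw [absolutelyContinuousOnInterval_iff] at h1 ⊢
  intro ε hε
  obtain ⟨δ, hδ, H⟩ := h1 ε hε
  refine ⟨δ, hδ, fun E hE hd => lt_of_le_of_lt (Finset.sum_le_sum fun i hi => ?_) (H E hE hd)⟩
  have hm := hE.1 i hi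
  rw [uIcc_of_le ht] at hm
  have nn : ∀ r ∈ Icc t0 t, 0 ≤ ∫ s in t0..r, q s := fun r hr =>
    intervalIntegral.integral_nonneg hr.1 fun s _ => hq0 s
  have a1 := nn _ hm.1
  have a2 := nn _ hm.2
  generalize (∫ s in t0..(E.2 i).1, q s) = A at *
  generalize (∫ s in t0..(E.2 i).2, q s) = B at *
  rw [Real.dist_eq, Real.dist_eq]
  have key : ∀ A B : ℝ, 0 ≤ A → A ≤ B → |Real.exp (-A) - Real.exp (-B)| ≤ |A - B| := by
    intro A B hA hAB
    rw [abs_of_nonneg (by simpa using hAB), abs_of_nonpos (by linarith)]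
    have e1 : Real.exp (-B) = Real.exp (-A) * Real.exp (-(B - A)) := by
      rw [← Real.exp_add]; congr 1; ring
    have e2 := Real.add_one_le_exp (-(B - A))
    have e3 : Real.exp (-A) ≤ 1 := by simpa using hA
    have e4 := Real.exp_pos (-A)
    rw [e1]
    nlinarith
  rcases le_total A B with h | h
  · exact key A B a1 h
  · rw [abs_sub_comm, abs_sub_comm A B]; exact key B A a2 h

/-- variation of constants identity -/
lemma aux_exp_int {q g : ℝ → ℝ} (hq : ∀ a b, IntervalIntegrable q volume a b)
    (hg : ∀ a b, IntervalIntegrable g volume a b)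
    (hq0 : ∀ s, 0 ≤ q s) {t0 t : ℝ} (ht : t0 ≤ t) (c : ℝ) :
    Real.exp (-∫ s in t0..t, q s) * (c + ∫ s in t0..t, g s) =
      c + ∫ r in t0..t, (g r - q r * (c + ∫ s in t0..r, g s)) * Real.exp (-∫ s in t0..r, q s) := by
  have h1 := aux_exp_ac hq hq0 ht
  have h2 : AbsolutelyContinuousOnInterval (fun r => c + ∫ s in t0..r, g s) t0 t := by
    have := (hg t0 t).absolutelyContinuousOnInterval_intervalIntegral (c := t0)
      (by simp [ht])
    have hc : AbsolutelyContinuousOnInterval (fun _ : ℝ => c) t0 t :=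
      (contDiffOn_const (n := 1)).absolutelyContinuousOnInterval
    exact hc.add this
  have h3 := (h1.mul h2).integral_deriv_eq_sub
  simp only [Pi.mul_apply, intervalIntegral.integral_same, neg_zero, Real.exp_zero, add_zero,
    one_mul] at h3
  rw [eq_comm, ← eq_sub_iff_add_eq'] 
  rw [← h3]
  apply intervalIntegral.integral_congr_ae
  filter_upwards [(hq t0 t).ae_hasDerivAt_integral, (hg t0 t).ae_hasDerivAt_integral]
    with r hr1 hr2 hr
  have hr' : r ∈ uIcc t0 t := uIoc_subset_uIcc hr
  have d1 := hr1 hr' t0 (by simp)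
  have d2 := hr2 hr' t0 (by simp)
  have := (d1.neg.exp.mul (d2.const_add c)).deriv
  rw [show ((fun r => Real.exp (-∫ s in t0..r, q s)) * fun r => c + ∫ s in t0..r, g s) =
    ((fun r => Real.exp ((-fun r => ∫ s in t0..r, q s) r)) * fun r => c + ∫ s in t0..r, g s) from rfl]
  rw [this]
  simp only [Pi.neg_apply]
  ring

lemma aux_pos {y B : ℝ → ℝ} {t0 T : ℝ} (hT : t0 ≤ T) (hy : ContinuousOn y (Icc t0 T))
    (hy0 : ∀ t ∈ Icc t0 T, 0 ≤ y t) (hy1 : 0 < y t0)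
    (hB : ∀ a b, IntervalIntegrable B volume a b) (hB0 : ∀ s, 0 ≤ B s)
    (H : ∀ t1 t2, t0 ≤ t1 → t1 ≤ t2 → t2 ≤ T → y t1 - (∫ s in t1..t2, B s * y s) ≤ y t2) :
    0 < y T := by
  by_contra hneg
  have hyT : y T = 0 := le_antisymm (not_lt.1 hneg) (hy0 T ⟨hT, le_rfl⟩)
  set Z := {t | t ∈ Icc t0 T ∧ y t = 0} with hZ
  have hZc : IsClosed Z := by
    have := hy.preimage_isClosed_of_isClosed isClosed_Icc (isClosed_singleton (x := (0:ℝ)))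
    convert this using 1
    ext t; exact Iff.rfl
  have hZn : Z.Nonempty := ⟨T, ⟨hT, le_rfl⟩, hyT⟩
  have hZb : BddBelow Z := ⟨t0, fun t ht => ht.1.1⟩
  have hmem := hZc.csInf_mem hZn hZb
  set τ := sInf Z with hτ
  have hτ0 : t0 < τ := by
    rcases eq_or_lt_of_le hmem.1.1 with h | h
    · rw [← h] at hmem; linarith [hmem.2]
    · exact h
  have hcont : Continuous fun r => ∫ s in τ..r, B s := intervalIntegral.continuous_primitive hB τ
  have h1 : ∀ᶠ r in 𝓝 τ, |∫ s in τ..r, B s| < 1/2 := by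
    have := hcont.abs.tendsto τ
    simp only [intervalIntegral.integral_same, abs_zero] at this
    exact this.eventually (gt_mem_nhds (by norm_num))
  have h2 : ∀ᶠ r in 𝓝[<] τ, r ∈ Ioo t0 τ := Ioo_mem_nhdsLT hτ0
  obtain ⟨t1, ht1, ht1'⟩ := ((h1.filter_mono nhdsWithin_le_nhds).and h2).exists
  have hsub : Icc t1 τ ⊆ Icc t0 T := Icc_subset_Icc ht1'.1.le hmem.1.2
  obtain ⟨t2, ht2, hmax⟩ := isCompact_Icc.exists_isMaxOn (nonempty_Icc.2 ht1'.2.le) (hy.mono hsub)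
  have hyt1 : 0 < y t1 := by
    refine lt_of_le_of_ne (hy0 _ (hsub ⟨le_rfl, ht1'.2.le⟩)) fun h => ?_
    have : τ ≤ t1 := csInf_le hZb ⟨hsub ⟨le_rfl, ht1'.2.le⟩, h.symm⟩
    linarith [ht1'.2]
  have hyt2 : y t1 ≤ y t2 := hmax ⟨le_rfl, ht1'.2.le⟩
  have h3 := H t2 τ (hsub ht2).1 ht2.2 hmem.1.2
  have h4 : (∫ s in t2..τ, B s * y s) ≤ ∫ s in t2..τ, B s * y t2 := by
    apply intervalIntegral.integral_mono_on ht2.2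
    · apply (hB _ _).mul_continuousOn
      rw [uIcc_of_le ht2.2]
      exact hy.mono ((Icc_subset_Icc ht2.1 le_rfl).trans hsub)
    · exact (hB _ _).mul_const _
    · intro s hs
      exact mul_le_mul_of_nonneg_left (hmax ⟨ht2.1.trans hs.1, hs.2⟩) (hB0 s)
  rw [intervalIntegral.integral_mul_const] at h4
  have h5 : (∫ s in t2..τ, B s) ≤ ∫ s in t1..τ, B s := by
    rw [← intervalIntegral.integral_add_adjacent_intervals (hB t1 t2) (hB t2 τ)]
    have := intervalIntegral.integral_nonneg (μ := volume) ht2.1 fun s _ => hB0 s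
    linarith
  rw [intervalIntegral.integral_symm, abs_neg] at ht1
  have h6 := (abs_lt.1 ht1).2
  rw [hmem.2] at h3
  nlinarith

lemma aux_sum_int {κ : Type*} (A : Finset κ) (f : κ → ℝ → ℝ)
    (hf : ∀ k a b, IntervalIntegrable (f k) volume a b) (a b : ℝ) :
    IntervalIntegrable (fun r => ∑ k ∈ A, f k r) volume a b := by
  classical
  induction A using Finset.induction_on with
  | empty => simp
  | insert k A hk ih =>
    simp only [Finset.sum_insert hk]
    exact (hf k a b).add ih

/-- Scalar linear delayed averaging system from time `T0` on. -/
structure LS (b h : V → V → ℝ → ℝ) (hbar T0 : ℝ) (x : V → ℝ → ℝ) : Prop where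
  hb0 : 0 ≤ hbar
  bnn : ∀ i j s, 0 ≤ b i j s
  bint : ∀ i j t1 t2, IntervalIntegrable (b i j) volume t1 t2
  hh : ∀ i j s, T0 ≤ s → 0 ≤ h i j s ∧ h i j s ≤ hbar
  cont : ∀ i, ContinuousOn (x i) (Ici (T0 - hbar))
  int : ∀ i t1 t2, T0 ≤ t1 → t1 ≤ t2 →
    IntervalIntegrable (fun s => ∑ j, b i j s * (x j (s - h i j s) - x i s)) volume t1 t2
  eq : ∀ i t1 t2, T0 ≤ t1 → t1 ≤ t2 →
    x i t2 - x i t1 = ∫ s in t1..t2, ∑ j, b i j s * (x j (s - h i j s) - x i s)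

lemma LS.neg {b h : V → V → ℝ → ℝ} {hbar T0 : ℝ} {x : V → ℝ → ℝ} (H : LS b h hbar T0 x) :
    LS b h hbar T0 (fun i t => - x i t) where
  hb0 := H.hb0
  bnn := H.bnn
  bint := H.bint
  hh := H.hh
  cont := fun i => (H.cont i).neg
  int := fun i t1 t2 h1 h2 => by
    convert (H.int i t1 t2 h1 h2).neg using 1
    ext s
    simp only [Pi.neg_apply, ← Finset.sum_neg_distrib]
    exact Finset.sum_congr rfl fun j _ => by ring
  eq := fun i t1 t2 h1 h2 => by
    have := H.eq i t1 t2 h1 h2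
    rw [show -x i t2 - -x i t1 = -(x i t2 - x i t1) by ring, this,
      ← intervalIntegral.integral_neg]
    congr 1
    ext s
    simp only [← Finset.sum_neg_distrib]
    exact Finset.sum_congr rfl fun j _ => by ring

/-- Subsolutions on a block. -/
def IsSub (b h : V → V → ℝ → ℝ) (t0 T : ℝ) (s : V → ℝ → ℝ) : Prop :=
  (∀ i, ContinuousOn (s i) (Icc t0 T)) ∧
  ∃ σ : V → ℝ → ℝ, (∀ i, IntervalIntegrable (σ i) volume t0 T) ∧
    (∀ i, ∀ t ∈ Icc t0 T, s i t = s i t0 + ∫ r in t0..t, σ i r) ∧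
    ∀ i, ∀ r ∈ Ioc t0 T, σ i r ≤ ∑ j, b i j r * (s j (r - h i j r) - s i r)

lemma IsSub.comb {b h : V → V → ℝ → ℝ} {t0 T : ℝ} {κ : Type*} (A : Finset κ)
    (g : κ → ℝ) (hg : ∀ k ∈ A, 0 ≤ g k) (s : κ → V → ℝ → ℝ)
    (hs : ∀ k ∈ A, IsSub b h t0 T (s k)) (m : ℝ) :
    IsSub b h t0 T (fun i t => m + ∑ k ∈ A, g k * s k i t) := by
  classical
  induction A using Finset.induction_on with
  | empty =>
    refine ⟨fun i => by simpa using continuousOn_const, fun _ _ => 0, fun i => by simp,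
      fun i t _ => by simp, fun i r _ => by simp⟩
  | insert k A hk ih =>
    obtain ⟨c1, σ1, i1, e1, l1⟩ := ih (fun k hk => hg k (by simp [hk])) (fun k hk => hs k (by simp [hk]))
    obtain ⟨c2, σ2, i2, e2, l2⟩ := hs k (by simp)
    have hgk := hg k (by simp)
    simp only [Finset.sum_insert hk]
    refine ⟨fun i => ?_, fun i r => g k * σ2 i r + σ1 i r, fun i => ((i2 i).const_mul _).add (i1 i),
      fun i t ht => ?_, fun i r hr => ?_⟩
    · have := ((c2 i).const_mul (g k)).add (c1 i)
      refine this.congr fun t _ => ?_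
      simp only [Pi.add_apply]; ring
    · have s1 : uIcc t0 t ⊆ uIcc t0 T := by
        rw [uIcc_of_le ht.1, uIcc_of_le (ht.1.trans ht.2)]; exact Icc_subset_Icc le_rfl ht.2
      rw [intervalIntegral.integral_add (((i2 i).mono_set s1).const_mul _) ((i1 i).mono_set s1),
        intervalIntegral.integral_const_mul]
      have a1 := e1 i t ht
      have a2 := e2 i t ht
      simp only at a1 ⊢
      rw [a2]
      linarith
    · have a1 := l1 i r hr
      have a2 := mul_le_mul_of_nonneg_left (l2 i r hr) hgk
      refine (add_le_add a2 a1).trans (le_of_eq ?_)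
      rw [Finset.mul_sum, ← Finset.sum_add_distrib]
      exact Finset.sum_congr rfl fun j _ => by ring

/-- Comparison principle. -/
lemma LS.comparison {b h : V → V → ℝ → ℝ} {hbar T0 : ℝ} {x : V → ℝ → ℝ} (H : LS b h hbar T0 x)
    {t0 T : ℝ} (h0 : T0 ≤ t0) {s : V → ℝ → ℝ} (hs : IsSub b h t0 T s)
    (hist : ∀ i, ∀ t ∈ Icc (t0 - hbar) t0, s i t ≤ x i t) :
    ∀ i, ∀ t ∈ Icc t0 T, s i t ≤ x i t := by
  intro i' t' ht'
  by_contra hcon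
  push Not at hcon
  have hT : t0 ≤ T := ht'.1.trans ht'.2
  obtain ⟨c, σ, iσ, eσ, lσ⟩ := hs
  have hb0 := H.hb0
  have hzc : ∀ i, ContinuousOn (fun t => x i t - s i t) (Icc t0 T) := fun i =>
    ((H.cont i).mono fun t ht => by simp only [mem_Ici]; linarith [ht.1]).sub (c i)
  choose τ hτ hmin using fun i => isCompact_Icc.exists_isMinOn (nonempty_Icc.2 hT) (hzc i)
  have : Nonempty V := ⟨i'⟩
  obtain ⟨i, hi⟩ := Finite.exists_min fun i => x i (τ i) - s i (τ i)
  set μ := x i (τ i) - s i (τ i) with hμ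
  have hμ0 : μ < 0 := by
    have := hi i'
    have h2 : x i' (τ i') - s i' (τ i') ≤ x i' t' - s i' t' := hmin i' ht'
    linarith
  have hall : ∀ j, ∀ t ∈ Icc (t0 - hbar) T, μ ≤ x j t - s j t := by
    intro j t ht
    rcases le_total t t0 with h | h
    · linarith [hist j t ⟨ht.1, h⟩]
    · exact (hi j).trans (hmin j ⟨h, ht.2⟩)
  set y : ℝ → ℝ := fun t => x i t - s i t - μ with hy
  set B : ℝ → ℝ := fun r => ∑ j, b i j r with hB
  have hBint : ∀ a' b', IntervalIntegrable B volume a' b' := fun a' b' => by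
    exact aux_sum_int Finset.univ (fun j => b i j) (fun j => H.bint i j) a' b'
  have hsub : Icc t0 (τ i) ⊆ Icc t0 T := Icc_subset_Icc le_rfl (hτ i).2
  have hyc : ContinuousOn y (Icc t0 T) := (hzc i).sub continuousOn_const
  have key : 0 < y (τ i) := by
    refine aux_pos (hτ i).1 (hyc.mono hsub)
      (fun t ht => ?_) ?_ hBint (fun r => Finset.sum_nonneg fun j _ => H.bnn i j r) ?_
    · have := hall i t ⟨by linarith [ht.1], (hsub ht).2⟩
      simp only [hy]; linarith
    · have := hist i t0 ⟨by linarith, le_rfl⟩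
      simp only [hy]; linarith
    · intro t1 t2 h1 h2 h3
      have h3' : t2 ≤ T := h3.trans (hτ i).2
      have ex := H.eq i t1 t2 (h0.trans h1) h2
      have ix := H.int i t1 t2 (h0.trans h1) h2
      have s1 : ∀ {u v}, t0 ≤ u → u ≤ v → v ≤ T → uIcc u v ⊆ uIcc t0 T := by
        intro u v a1 a2 a3
        rw [uIcc_of_le a2, uIcc_of_le hT]; exact Icc_subset_Icc a1 a3
      have es : s i t2 - s i t1 = ∫ r in t1..t2, σ i r := by
        rw [eσ i t1 ⟨h1, h2.trans h3'⟩, eσ i t2 ⟨h1.trans h2, h3'⟩,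
          ← intervalIntegral.integral_add_adjacent_intervals
            ((iσ i).mono_set (s1 le_rfl h1 (h2.trans h3'))) ((iσ i).mono_set (s1 h1 h2 h3'))]
        ring
      have hle : -(∫ r in t1..t2, B r * y r) ≤
          ∫ r in t1..t2, ((∑ j, b i j r * (x j (r - h i j r) - x i r)) - σ i r) := by
        rw [← intervalIntegral.integral_neg]
        apply intervalIntegral.integral_mono_on_of_le_Ioo h2
        · apply IntervalIntegrable.neg
          apply (hBint _ _).mul_continuousOn
          apply hyc.mono
          rw [uIcc_of_le h2]
          exact Icc_subset_Icc h1 h3'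
        · exact ix.sub ((iσ i).mono_set (s1 h1 h2 h3'))
        · intro r hr
          have a1 := lσ i r ⟨by linarith [hr.1], by linarith [hr.2]⟩
          have a2 : -(B r * y r) ≤ ∑ j, b i j r * ((x j (r - h i j r) - x i r) -
              (s j (r - h i j r) - s i r)) := by
            simp only [hB, Finset.sum_mul, ← Finset.sum_neg_distrib]
            apply Finset.sum_le_sum
            intro j _
            have a3 := H.hh i j r (by linarith [hr.1])
            have a4 := hall j (r - h i j r) ⟨by linarith [hr.1], by linarith [hr.2]⟩
            have a5 := mul_le_mul_of_nonneg_left a4 (H.bnn i j r)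
            simp only [hy]
            nlinarith
          have a6 : ∑ j, b i j r * ((x j (r - h i j r) - x i r) -
              (s j (r - h i j r) - s i r)) = (∑ j, b i j r * (x j (r - h i j r) - x i r)) -
              ∑ j, b i j r * (s j (r - h i j r) - s i r) := by
            rw [← Finset.sum_sub_distrib]
            exact Finset.sum_congr rfl fun j _ => by ring
          linarith
      rw [intervalIntegral.integral_sub ix ((iσ i).mono_set (s1 h1 h2 h3')), ← ex, ← es] at hle
      simp only [hy]
      linarith
  simp only [hy] at key
  linarith

/-- Lower bounds propagate. -/
lemma LS.lower {b h : V → V → ℝ → ℝ} {hbar T0 : ℝ} {x : V → ℝ → ℝ} (H : LS b h hbar T0 x)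
    {t0 : ℝ} (h0 : T0 ≤ t0) {m : ℝ} (hist : ∀ i, ∀ t ∈ Icc (t0 - hbar) t0, m ≤ x i t) :
    ∀ i, ∀ t, t0 - hbar ≤ t → m ≤ x i t := by
  intro i t ht
  rcases le_total t t0 with h1 | h1
  · exact hist i t ⟨ht, h1⟩
  · have := IsSub.comb (b := b) (h := h) (t0 := t0) (T := t) (∅ : Finset ℕ) (fun _ => 0) (by simp)
      (fun _ _ _ => 0) (by simp) m
    have := H.comparison h0 this (by simpa using hist) i t ⟨h1, le_rfl⟩
    simpa using this

lemma aux_int_mono {q : ℝ → ℝ} (hq : ∀ a b, IntervalIntegrable q volume a b)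
    (hq0 : ∀ s, 0 ≤ q s) {t0 t t' : ℝ} (h : t ≤ t') :
    (∫ s in t0..t, q s) ≤ ∫ s in t0..t', q s := by
  rw [← intervalIntegral.integral_add_adjacent_intervals (hq t0 t) (hq t t')]
  have := intervalIntegral.integral_nonneg (μ := volume) h fun s _ => hq0 s
  linarith

lemma LS.sub2 {b h : V → V → ℝ → ℝ} {hbar T0 : ℝ} {x : V → ℝ → ℝ} (H : LS b h hbar T0 x)
    {t0 T : ℝ} (hT : t0 ≤ T) (Hu Hv : Finset V) :
    ∃ s : V → ℝ → ℝ, IsSub b h t0 T s ∧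
      (∀ i, ∀ t < t0, s i t = if i ∈ Hu then 1 else 0) ∧
      (∀ i, s i t0 = if i ∈ Hv then 1 else 0) ∧
      (∀ i t, 0 ≤ s i t) ∧
      (∀ i ∈ Hv, ∀ t ∈ Icc t0 T, Real.exp (-∫ r in t0..T, ∑ i, ∑ j, b i j r) ≤ s i t) := by
  set B : ℝ → ℝ := fun r => ∑ i, ∑ j, b i j r with hB
  have hBint : ∀ a' b', IntervalIntegrable B volume a' b' :=
    aux_sum_int _ _ fun i => aux_sum_int _ _ fun j => H.bint i j
  have hB0 : ∀ r, 0 ≤ B r := fun r => Finset.sum_nonneg fun i _ => Finset.sum_nonneg fun j _ => H.bnn i j r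
  have hQc : Continuous fun t => ∫ r in t0..t, B r := intervalIntegral.continuous_primitive hBint t0
  have hs0 : ∀ i t, 0 ≤ (if t < t0 then (if i ∈ Hu then (1:ℝ) else 0)
      else (if i ∈ Hv then Real.exp (-∫ r in t0..t, B r) else 0)) := by
    intro i t
    split_ifs <;> first | positivity | exact le_rfl
  refine ⟨fun i t => if t < t0 then (if i ∈ Hu then 1 else 0)
      else (if i ∈ Hv then Real.exp (-∫ r in t0..t, B r) else 0), ⟨fun i => ?_,
      fun i r => if i ∈ Hv then (0 - B r * (1 + ∫ s in t0..r, (0:ℝ))) * Real.exp (-∫ s in t0..r, B s) else 0,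
      fun i => ?_, fun i t ht => ?_, fun i r hr => ?_⟩, fun i t ht => by simp [ht],
      fun i => by simp, hs0, fun i hi t ht => ?_⟩
  · by_cases hi : i ∈ Hv
    · refine (hQc.neg.rexp.continuousOn).congr fun t ht => ?_
      simp [hi, not_lt.2 ht.1]
    · refine (continuousOn_const (c := (0:ℝ))).congr fun t ht => ?_
      simp [hi, not_lt.2 ht.1]
  · by_cases hi : i ∈ Hv
    · simp only [hi, if_true, intervalIntegral.integral_zero, add_zero, mul_one, zero_sub]
      exact ((hBint t0 T).neg).mul_continuousOn hQc.neg.rexp.continuousOn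
    · simp [hi]
  · by_cases hi : i ∈ Hv
    · have := aux_exp_int hBint (g := fun _ => 0) (fun _ _ => by simp) hB0 ht.1 1
      simp only [hi, not_lt.2 ht.1, if_true, if_false, lt_irrefl, intervalIntegral.integral_same,
        neg_zero, Real.exp_zero]
      rw [← this]; simp
    · simp [hi, not_lt.2 ht.1]
  · have hterm : ∀ j, -(b i j r * (if i ∈ Hv then Real.exp (-∫ r in t0..r, B r) else 0)) ≤
        b i j r * ((fun i t => if t < t0 then (if i ∈ Hu then (1:ℝ) else 0)
      else (if i ∈ Hv then Real.exp (-∫ r in t0..t, B r) else 0)) j (r - h i j r)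
        - (fun i t => if t < t0 then (if i ∈ Hu then (1:ℝ) else 0)
      else (if i ∈ Hv then Real.exp (-∫ r in t0..t, B r) else 0)) i r) := by
      intro j
      have a1 := mul_nonneg (H.bnn i j r) (hs0 j (r - h i j r))
      simp only [not_lt.2 hr.1.le, if_false] at a1 ⊢
      rw [mul_sub]
      linarith
    refine le_trans ?_ (Finset.sum_le_sum fun j _ => hterm j)
    rw [Finset.sum_neg_distrib, ← Finset.sum_mul]
    by_cases hi : i ∈ Hv
    · simp only [hi, if_true, intervalIntegral.integral_zero, add_zero, mul_one, zero_sub, neg_mul]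
      have : ∑ j, b i j r ≤ B r :=
        Finset.single_le_sum (f := fun i => ∑ j, b i j r)
          (fun i _ => Finset.sum_nonneg fun j _ => H.bnn i j r) (Finset.mem_univ i)
      have := mul_le_mul_of_nonneg_right this (Real.exp_pos (-∫ s in t0..r, B s)).le
      linarith
    · simp [hi]
  · simp only [hi, not_lt.2 ht.1, if_true, if_false]
    apply Real.exp_le_exp.2
    apply neg_le_neg
    exact aux_int_mono hBint hB0 ht.2

lemma LS.sub1 {b h : V → V → ℝ → ℝ} {hbar T0 : ℝ} {x : V → ℝ → ℝ} (H : LS b h hbar T0 x)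
    {t0 T : ℝ} (h0 : T0 ≤ t0) (hT : t0 ≤ T) (A : Finset V) :
    ∃ s : V → ℝ → ℝ, IsSub b h t0 T s ∧
      (∀ i, ∀ t ≤ t0, s i t = if i ∈ A then 1 else 0) ∧
      (∀ i t, 0 ≤ s i t) ∧
      (∀ i ∈ A, ∀ t ∈ Icc t0 T, Real.exp (-∫ r in t0..T, ∑ i, ∑ j, b i j r) ≤ s i t ∧
        1 - (∫ r in t0..T, ∑ i ∈ A, ∑ j ∈ Aᶜ, b i j r) ≤ s i t) ∧
      (∀ i ∉ A, Real.exp (-∫ r in t0..T, ∑ i, ∑ j, b i j r) *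
        Real.exp (-∫ r in t0..T, ∑ i, ∑ j, b i j r) * (∫ r in t0..T, ∑ j ∈ A, b i j r) ≤ s i T) := by
  set B : ℝ → ℝ := fun r => ∑ i, ∑ j, b i j r with hB
  have hBint : ∀ a' b', IntervalIntegrable B volume a' b' :=
    aux_sum_int _ _ fun i => aux_sum_int _ _ fun j => H.bint i j
  have hB0 : ∀ r, 0 ≤ B r := fun r => Finset.sum_nonneg fun i _ => Finset.sum_nonneg fun j _ => H.bnn i j r
  have hQc : Continuous fun t => ∫ r in t0..t, B r := intervalIntegral.continuous_primitive hBint t0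
  set p : ℝ → ℝ := fun r => ∑ i ∈ A, ∑ j ∈ Aᶜ, b i j r with hp
  have hpint : ∀ a' b', IntervalIntegrable p volume a' b' :=
    aux_sum_int _ _ fun i => aux_sum_int _ _ fun j => H.bint i j
  have hp0 : ∀ r, 0 ≤ p r := fun r => Finset.sum_nonneg fun i _ => Finset.sum_nonneg fun j _ => H.bnn i j r
  have hPc : Continuous fun t => ∫ r in t0..t, p r := intervalIntegral.continuous_primitive hpint t0
  set g : V → ℝ → ℝ := fun i r => ∑ j ∈ A, b i j r with hg
  have hgint : ∀ i, ∀ a' b', IntervalIntegrable (g i) volume a' b' := fun i =>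
    aux_sum_int _ _ fun j => H.bint i j
  have hg0 : ∀ i r, 0 ≤ g i r := fun i r => Finset.sum_nonneg fun j _ => H.bnn i j r
  have hGc : ∀ i, Continuous fun t => ∫ r in t0..t, g i r := fun i =>
    intervalIntegral.continuous_primitive (hgint i) t0
  have hpB : ∀ r, p r ≤ B r := fun r => by
    refine (Finset.sum_le_sum fun i _ => Finset.sum_le_sum_of_subset_of_nonneg
      (Finset.subset_univ _) fun j _ _ => H.bnn i j r).trans
      (Finset.sum_le_sum_of_subset_of_nonneg (Finset.subset_univ _) fun i _ _ =>
        Finset.sum_nonneg fun j _ => H.bnn i j r)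
  set κ := Real.exp (-∫ r in t0..T, B r) with hκ
  have hκ0 : 0 < κ := Real.exp_pos _
  set s : V → ℝ → ℝ := fun i t => if i ∈ A then Real.exp (-∫ r in t0..(max t t0), p r) else
    κ * (Real.exp (-∫ r in t0..(max t t0), B r) * (0 + ∫ r in t0..(max t t0), g i r)) with hs
  have hGnn : ∀ i t, 0 ≤ ∫ r in t0..(max t t0), g i r := fun i t =>
    intervalIntegral.integral_nonneg (le_max_right _ _) fun r _ => hg0 i r
  have hs0 : ∀ i t, 0 ≤ s i t := by
    intro i t
    simp only [hs]
    have := hGnn i t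
    split_ifs <;> positivity
  have hanti : ∀ i ∈ A, ∀ t t', t ≤ t' → s i t' ≤ s i t := by
    intro i hi t t' htt
    simp only [hs, hi, if_true]
    apply Real.exp_le_exp.2
    apply neg_le_neg
    exact aux_int_mono hpint hp0 (max_le_max_right _ htt)
  have hlow : ∀ i ∈ A, ∀ t ≤ T, κ ≤ s i t := by
    intro i hi t ht
    refine le_trans ?_ (hanti i hi t T ht)
    simp only [hs, hi, if_true, hκ, max_eq_left hT]
    apply Real.exp_le_exp.2
    apply neg_le_neg
    exact intervalIntegral.integral_mono_on hT (hpint _ _) (hBint _ _) fun r _ => hpB r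
  refine ⟨s, ⟨fun i => ?_,
      fun i r => if i ∈ A then (0 - p r * (1 + ∫ s in t0..r, (0:ℝ))) * Real.exp (-∫ s in t0..r, p s)
        else κ * ((g i r - B r * (0 + ∫ s in t0..r, g i s)) * Real.exp (-∫ s in t0..r, B s)),
      fun i => ?_, fun i t ht => ?_, fun i r hr => ?_⟩, fun i t ht => by simp [hs, ht],
      hs0, fun i hi t ht => ⟨hlow i hi t ht.2, ?_⟩, fun i hi => ?_⟩
  · have hm : Continuous fun t : ℝ => max t t0 := continuous_id.max continuous_const
    by_cases hi : i ∈ A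
    · simp only [hs, hi, if_true]
      exact ((hPc.comp hm).neg.rexp).continuousOn
    · simp only [hs, hi, if_false]
      exact (continuous_const.mul (((hQc.comp hm).neg.rexp).mul
        (continuous_const.add ((hGc i).comp hm)))).continuousOn
  · by_cases hi : i ∈ A
    · simp only [hi, if_true, intervalIntegral.integral_zero, add_zero, mul_one, zero_sub]
      exact ((hpint t0 T).neg).mul_continuousOn hPc.neg.rexp.continuousOn
    · simp only [hi, if_false]
      exact (((hgint i t0 T).sub ((hBint t0 T).mul_continuousOn
        (continuous_const.add (hGc i)).continuousOn)).mul_continuousOn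
          hQc.neg.rexp.continuousOn).const_mul _
  · by_cases hi : i ∈ A
    · have := aux_exp_int hpint (g := fun _ => 0) (fun _ _ => by simp) hp0 ht.1 1
      simp only [hs, hi, max_eq_left ht.1, if_true, max_self, intervalIntegral.integral_same,
        neg_zero, Real.exp_zero]
      rw [← this]; simp
    · have := aux_exp_int hBint (hgint i) hB0 ht.1 0
      simp only [hs, hi, max_eq_left ht.1, if_false, max_self, intervalIntegral.integral_same,
        neg_zero, Real.exp_zero]
      rw [intervalIntegral.integral_const_mul, this]; simp
  · have hd : ∀ j, 0 ≤ h i j r := fun j => (H.hh i j r (h0.trans hr.1.le)).1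
    rw [← Finset.sum_add_sum_compl A]
    by_cases hi : i ∈ A
    · have t1 : 0 ≤ ∑ j ∈ A, b i j r * (s j (r - h i j r) - s i r) := by
        apply Finset.sum_nonneg
        intro j hj
        apply mul_nonneg (H.bnn i j r)
        have := hanti j hj (r - h i j r) r (by linarith [hd j])
        have e : s i r = s j r := by simp [hs, hi, hj]
        linarith
      have t2 : ∑ j ∈ Aᶜ, -(b i j r * s i r) ≤ ∑ j ∈ Aᶜ, b i j r * (s j (r - h i j r) - s i r) := by
        apply Finset.sum_le_sum
        intro j _
        have a1 := mul_nonneg (H.bnn i j r) (hs0 j (r - h i j r))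
        rw [mul_sub]; linarith
      rw [Finset.sum_neg_distrib, ← Finset.sum_mul] at t2
      have t3 : ∑ j ∈ Aᶜ, b i j r ≤ p r :=
        Finset.single_le_sum (f := fun i => ∑ j ∈ Aᶜ, b i j r)
          (fun i _ => Finset.sum_nonneg fun j _ => H.bnn i j r) hi
      have t4 := mul_le_mul_of_nonneg_right t3 (hs0 i r)
      have t5 : s i r = Real.exp (-∫ s in t0..r, p s) := by simp [hs, hi, max_eq_left hr.1.le]
      simp only [hi, if_true, intervalIntegral.integral_zero, add_zero, mul_one, zero_sub, neg_mul]
      rw [← t5]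
      linarith
    · have t1 : ∑ j ∈ A, (κ * b i j r - b i j r * s i r) ≤
          ∑ j ∈ A, b i j r * (s j (r - h i j r) - s i r) := by
        apply Finset.sum_le_sum
        intro j hj
        have := hlow j hj (r - h i j r) (by linarith [hd j, hr.2])
        have := mul_le_mul_of_nonneg_left this (H.bnn i j r)
        rw [mul_sub]; linarith
      have t2 : ∑ j ∈ Aᶜ, -(b i j r * s i r) ≤ ∑ j ∈ Aᶜ, b i j r * (s j (r - h i j r) - s i r) := by
        apply Finset.sum_le_sum
        intro j _
        have a1 := mul_nonneg (H.bnn i j r) (hs0 j (r - h i j r))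
        rw [mul_sub]; linarith
      rw [Finset.sum_neg_distrib, ← Finset.sum_mul] at t2
      rw [Finset.sum_sub_distrib, ← Finset.sum_mul, ← Finset.mul_sum] at t1
      have t3 : ∑ j, b i j r ≤ B r :=
        Finset.single_le_sum (f := fun i => ∑ j, b i j r)
          (fun i _ => Finset.sum_nonneg fun j _ => H.bnn i j r) (Finset.mem_univ i)
      rw [← Finset.sum_add_sum_compl A] at t3
      have t4 := mul_le_mul_of_nonneg_right t3 (hs0 i r)
      have t5 : s i r = κ * (Real.exp (-∫ s in t0..r, B s) * ∫ s in t0..r, g i s) := by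
        simp [hs, hi, max_eq_left hr.1.le]
      have t6 : Real.exp (-∫ s in t0..r, B s) ≤ 1 := by
        rw [Real.exp_le_one_iff]
        have := intervalIntegral.integral_nonneg (μ := volume) hr.1.le fun s _ => hB0 s
        linarith
      have t7 := mul_le_mul_of_nonneg_left t6 (mul_nonneg hκ0.le (hg0 i r))
      simp only [hi, if_false, zero_add]
      have t8 : κ * ((g i r - B r * ∫ s in t0..r, g i s) * Real.exp (-∫ s in t0..r, B s)) =
          κ * g i r * Real.exp (-∫ s in t0..r, B s) - B r * s i r := by rw [t5]; ring
      rw [t8]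
      have t9 : g i r = ∑ j ∈ A, b i j r := rfl
      rw [← t9] at t1 t4
      linarith
  · have e1 : s i t = Real.exp (-∫ r in t0..t, p r) := by simp [hs, hi, max_eq_left ht.1]
    have e2 := Real.add_one_le_exp (-∫ r in t0..t, p r)
    have e3 := aux_int_mono (t0 := t0) hpint hp0 ht.2
    rw [e1]; linarith
  · simp only [hs, hi, if_false, max_eq_left hT, zero_add]
    rw [← hκ]
    exact le_of_eq (by ring)

lemma aux_geom {N k : ℕ} (hk : k + 1 < N) {γ : ℝ} (hγ : 0 < γ) :
    ∑ l : Fin N, (1 + 1/γ)^(N-1-(l:ℕ)) * (if k < (l:ℕ) then (1:ℝ) else 0)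
      = γ * ((1 + 1/γ)^(N-1-k) - 1) := by
  rw [Fin.sum_univ_eq_sum_range (fun l => (1 + 1/γ)^(N-1-l) * (if k < l then (1:ℝ) else 0)) N]
  have h1 : ∑ l ∈ Finset.range N, (1 + 1/γ)^(N-1-l) * (if k < l then (1:ℝ) else 0)
      = ∑ l ∈ Finset.range N, (1 + 1/γ)^l * (if k < N - 1 - l then (1:ℝ) else 0) := by
    rw [← Finset.sum_range_reflect]
    refine Finset.sum_congr rfl fun j hj => ?_
    have := Finset.mem_range.1 hj
    rw [show N - 1 - (N - 1 - j) = j by omega]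
  rw [h1]
  have h2 : ∑ l ∈ Finset.range N, (1 + 1/γ)^l * (if k < N - 1 - l then (1:ℝ) else 0)
      = ∑ l ∈ Finset.range (N-1-k), (1 + 1/γ)^l := by
    rw [← Finset.sum_subset (Finset.range_subset_range.2 (show N - 1 - k ≤ N by omega))]
    · refine Finset.sum_congr rfl fun j hj => ?_
      have := Finset.mem_range.1 hj
      rw [if_pos (by omega), mul_one]
    · intro j hj hj'
      simp only [Finset.mem_range] at hj hj'
      rw [if_neg (by omega), mul_zero]
  rw [h2, geom_sum_eq]
  · field_simp
    ring
  · have : 0 < 1/γ := by positivity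
    linarith

lemma keyK {E : Type*} [Fintype E] {N : ℕ} (e e' : E ≃ Fin N) {k : ℕ} (hk : k + 1 < N)
    {γ β D : ℝ} (s : E → ℝ) (hγ : 0 < γ) (hγβ : γ ≤ β) (hD0 : 0 ≤ D) (hD1 : D ≤ 1)
    (s0 : ∀ ν, 0 ≤ s ν) (h1 : ∀ ν, k < (e ν : ℕ) → β ≤ s ν ∧ 1 - D ≤ s ν)
    (h2 : ∃ ν0, (e ν0 : ℕ) ≤ k ∧ γ * D ≤ s ν0) :
    ∑ ν, (1 + 1/γ)^(N-1-(e ν : ℕ)) * (if k < (e ν : ℕ) then (1:ℝ) else 0) + γ * D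
      ≤ ∑ ν, (1 + 1/γ)^(N-1-(e' ν : ℕ)) * s ν := by
  classical
  have hθ : 1 ≤ 1 + 1/γ := by
    have : 0 < 1/γ := by positivity
    linarith
  have hθ0 : 0 < 1 + 1/γ := by linarith
  have hG := aux_geom hk hγ
  have hGe : ∀ f : E ≃ Fin N, ∑ ν, (1 + 1/γ)^(N-1-(f ν : ℕ)) * (if k < (f ν : ℕ) then (1:ℝ) else 0)
      = γ * ((1 + 1/γ)^(N-1-k) - 1) := fun f => by
    rw [← hG, ← Equiv.sum_comp f]
  rw [hGe]
  have hW : ∀ l, l ≤ k → (1 + 1/γ)^(N-1-k) ≤ (1 + 1/γ)^(N-1-l) := fun l hl =>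
    pow_le_pow_right₀ hθ (by omega)
  have hP : 0 < (1 + 1/γ)^(N-1-k) := by positivity
  by_cases hA : ∃ ν, k < (e ν : ℕ) ∧ (e' ν : ℕ) ≤ k
  · obtain ⟨ν, hν, hν'⟩ := hA
    have h3 : (1 + 1/γ)^(N-1-(e' ν : ℕ)) * s ν ≤ ∑ ν, (1 + 1/γ)^(N-1-(e' ν : ℕ)) * s ν :=
      Finset.single_le_sum (f := fun ν => (1 + 1/γ)^(N-1-(e' ν : ℕ)) * s ν)
        (fun i _ => mul_nonneg (by positivity) (s0 i)) (Finset.mem_univ ν)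
    have h4 : (1 + 1/γ)^(N-1-k) * γ ≤ (1 + 1/γ)^(N-1-(e' ν : ℕ)) * s ν :=
      mul_le_mul (hW _ hν') (hγβ.trans (h1 ν hν).1) hγ.le (by positivity)
    nlinarith
  · push Not at hA
    obtain ⟨ν0, hν0, hs0⟩ := h2
    have hcard : ∀ f : E ≃ Fin N, (Finset.univ.filter fun ν => k < (f ν : ℕ)).card
        = (Finset.univ.filter fun l : Fin N => k < (l : ℕ)).card := fun f => by
      refine Finset.card_bij (fun ν _ => f ν) (by simp) (fun _ _ _ _ h => f.injective h) ?_
      intro l hl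
      exact ⟨f.symm l, by simpa using hl, by simp⟩
    have hsub : (Finset.univ.filter fun ν => k < (e ν : ℕ))
        ⊆ Finset.univ.filter fun ν => k < (e' ν : ℕ) := by
      intro ν
      simpa using hA ν
    have heq := Finset.eq_of_subset_of_card_le hsub (by rw [hcard, hcard])
    have hiff : ∀ ν, k < (e ν : ℕ) ↔ k < (e' ν : ℕ) := fun ν => by
      have := Finset.ext_iff.1 heq ν
      simpa using this
    have key : ∀ ν, (1 - D) * ((1 + 1/γ)^(N-1-(e' ν : ℕ)) * (if k < (e' ν : ℕ) then (1:ℝ) else 0))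
        + (if ν = ν0 then (1 + 1/γ)^(N-1-k) * (γ * D) else 0)
        ≤ (1 + 1/γ)^(N-1-(e' ν : ℕ)) * s ν := by
      intro ν
      by_cases h : ν = ν0
      · subst h
        have : ¬ k < (e' ν : ℕ) := by
          rw [← hiff]; omega
        rw [if_neg this, if_pos rfl]
        have := mul_le_mul (hW _ (not_lt.1 this)) hs0 (by positivity) (by positivity)
        linarith
      · rw [if_neg h]
        by_cases h' : k < (e' ν : ℕ)
        · rw [if_pos h']
          have := mul_le_mul_of_nonneg_left (h1 ν ((hiff ν).2 h')).2
            (show 0 ≤ (1 + 1/γ)^(N-1-(e' ν : ℕ)) by positivity)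
          linarith
        · rw [if_neg h']
          have := mul_nonneg (show 0 ≤ (1 + 1/γ)^(N-1-(e' ν : ℕ)) by positivity) (s0 ν)
          linarith
    have := Finset.sum_le_sum fun ν (_ : ν ∈ Finset.univ) => key ν
    rw [Finset.sum_add_distrib, ← Finset.mul_sum, hGe] at this
    simp only [Finset.sum_ite_eq', Finset.mem_univ, if_true] at this
    linarith

lemma LS.bsum {b h : V → V → ℝ → ℝ} {hbar T0 : ℝ} {x : V → ℝ → ℝ}
    (H : LS b h hbar T0 x) (t0 T : ℝ) (i : V) (A : Finset V) :
    ∫ r in t0..T, ∑ j ∈ A, b i j r = ∑ j ∈ A, ∫ r in t0..T, b i j r :=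
  intervalIntegral.integral_finset_sum fun j _ => H.bint i j t0 T

lemma LS.bsum2 {b h : V → V → ℝ → ℝ} {hbar T0 : ℝ} {x : V → ℝ → ℝ}
    (H : LS b h hbar T0 x) (t0 T : ℝ) (A C : Finset V) :
    ∫ r in t0..T, ∑ i ∈ A, ∑ j ∈ C, b i j r = ∑ i ∈ A, ∑ j ∈ C, ∫ r in t0..T, b i j r := by
  rw [intervalIntegral.integral_finset_sum]
  · exact Finset.sum_congr rfl fun i _ => H.bsum t0 T i C
  · intro i _
    exact aux_sum_int C (fun j => b i j) (fun j => H.bint i j) t0 T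

lemma LS.wnn {b h : V → V → ℝ → ℝ} {hbar T0 : ℝ} {x : V → ℝ → ℝ}
    (H : LS b h hbar T0 x) {t0 T : ℝ} (hT : t0 ≤ T) (i j : V) : 0 ≤ ∫ r in t0..T, b i j r :=
  intervalIntegral.integral_nonneg hT fun r _ => H.bnn i j r

lemma LS.perk {b h : V → V → ℝ → ℝ} {hbar T0 : ℝ} {x : V → ℝ → ℝ}
    (H : LS b h hbar T0 x) {t0 T : ℝ} (h0 : T0 ≤ t0) (hT : t0 ≤ T) {K B γ : ℝ} (hK1 : 1 ≤ K)
    (hK : ∀ i j, i ≠ j → ∫ r in t0..T, b i j r ≤ K * ∫ r in t0..T, b j i r)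
    (hB : ∫ r in t0..T, ∑ i, ∑ j, b i j r ≤ B) (hγ : 0 < γ) (hγ1 : γ ≤ Real.exp (-B))
    (hγ2 : γ * (Fintype.card V * K) ≤ Real.exp (-B) * Real.exp (-B))
    (Hu Hv : Finset V) (hsub : Hu ⊆ Hv) (hne : Hu ≠ Finset.univ) :
    ∃ (s : V → ℝ → ℝ) (D : ℝ), 0 ≤ D ∧ D ≤ 1 ∧ IsSub b h t0 T s ∧
      (∀ i, ∀ t < t0, s i t = if i ∈ Hu then 1 else 0) ∧
      (∀ i, s i t0 = if i ∈ Hv then 1 else 0) ∧ (∀ i t, 0 ≤ s i t) ∧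
      (∀ i ∈ Hv, ∀ t ∈ Icc t0 T, Real.exp (-B) ≤ s i t ∧ 1 - D ≤ s i t) ∧
      ((∃ i, i ∉ Hv ∧ γ * D ≤ s i T) ∨ (∃ i, i ∉ Hu ∧ ∀ t ∈ Icc t0 T, γ * D ≤ s i t)) ∧
      (∀ i ∉ Hv, ∀ j ∈ Hu, min 1 (∫ r in t0..T, b j i r) ≤ D) := by
  have hE : Real.exp (-B) ≤ Real.exp (-∫ r in t0..T, ∑ i, ∑ j, b i j r) :=
    Real.exp_le_exp.2 (by linarith)
  by_cases heq : Hu = Hv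
  · subst heq
    obtain ⟨s, hs, h1, h2, h3, h4⟩ := H.sub1 h0 hT Hu
    have hS := H.bsum2 t0 T Hu Huᶜ
    have hS0 : 0 ≤ ∫ r in t0..T, ∑ i ∈ Hu, ∑ j ∈ Huᶜ, b i j r := by
      rw [hS]
      exact Finset.sum_nonneg fun i _ => Finset.sum_nonneg fun j _ => H.wnn hT i j
    refine ⟨s, min 1 (∫ r in t0..T, ∑ i ∈ Hu, ∑ j ∈ Huᶜ, b i j r), le_min zero_le_one hS0,
      min_le_left _ _, hs, fun i t ht => h1 i t ht.le, fun i => h1 i t0 le_rfl, h2, ?_, Or.inl ?_, ?_⟩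
    · intro i hi t ht
      obtain ⟨h5, h6⟩ := h3 i hi t ht
      refine ⟨hE.trans h5, ?_⟩
      rcases min_cases (1:ℝ) (∫ r in t0..T, ∑ i ∈ Hu, ∑ j ∈ Huᶜ, b i j r) with h7 | h7
      · rw [h7.1]; linarith [h2 i t]
      · rw [h7.1]; exact h6
    · have hne' : (Huᶜ).Nonempty := by
        rw [Finset.nonempty_iff_ne_empty]
        simpa using hne
      obtain ⟨i0, hi0, hmax⟩ := Finset.exists_max_image Huᶜ
        (fun i => ∫ r in t0..T, ∑ j ∈ Hu, b i j r) hne'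
      refine ⟨i0, by simpa using hi0, ?_⟩
      refine le_trans ?_ (h4 i0 (by simpa using hi0))
      set R := ∫ r in t0..T, ∑ j ∈ Hu, b i0 j r with hR
      have hR0 : 0 ≤ R := by
        rw [hR, H.bsum]
        exact Finset.sum_nonneg fun j _ => H.wnn hT i0 j
      have hSle : (∫ r in t0..T, ∑ i ∈ Hu, ∑ j ∈ Huᶜ, b i j r) ≤ K * (Fintype.card V * R) := by
        rw [hS]
        calc ∑ i ∈ Hu, ∑ j ∈ Huᶜ, ∫ r in t0..T, b i j r
            ≤ ∑ i ∈ Hu, ∑ j ∈ Huᶜ, K * ∫ r in t0..T, b j i r := by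
              refine Finset.sum_le_sum fun i hi => Finset.sum_le_sum fun j hj => hK i j ?_
              rintro rfl
              exact (Finset.mem_compl.1 hj) hi
          _ = K * ∑ j ∈ Huᶜ, ∫ r in t0..T, ∑ i ∈ Hu, b j i r := by
              rw [Finset.sum_comm, Finset.mul_sum]
              refine Finset.sum_congr rfl fun j _ => ?_
              rw [H.bsum, Finset.mul_sum]
          _ ≤ K * (Fintype.card V * R) := by
              refine mul_le_mul_of_nonneg_left ?_ (by linarith)
              refine (Finset.sum_le_card_nsmul _ _ R hmax).trans ?_
              rw [nsmul_eq_mul]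
              refine mul_le_mul_of_nonneg_right ?_ hR0
              exact_mod_cast Finset.card_le_univ _
      calc γ * min 1 (∫ r in t0..T, ∑ i ∈ Hu, ∑ j ∈ Huᶜ, b i j r)
          ≤ γ * (K * (Fintype.card V * R)) :=
            mul_le_mul_of_nonneg_left ((min_le_right _ _).trans hSle) hγ.le
        _ = (γ * (Fintype.card V * K)) * R := by ring
        _ ≤ (Real.exp (-B) * Real.exp (-B)) * R := mul_le_mul_of_nonneg_right hγ2 hR0
        _ ≤ _ := by
          refine mul_le_mul_of_nonneg_right ?_ hR0
          exact mul_le_mul hE hE (Real.exp_pos _).le (Real.exp_pos _).le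
    · intro i hi j hj
      refine min_le_min_left _ ?_
      rw [hS]
      calc (∫ r in t0..T, b j i r) ≤ ∑ j' ∈ Huᶜ, ∫ r in t0..T, b j j' r :=
            Finset.single_le_sum (f := fun j' => ∫ r in t0..T, b j j' r)
              (fun j' _ => H.wnn hT j j') (Finset.mem_compl.2 hi)
        _ ≤ _ := Finset.single_le_sum (f := fun i => ∑ j' ∈ Huᶜ, ∫ r in t0..T, b i j' r)
              (fun i' _ => Finset.sum_nonneg fun j' _ => H.wnn hT i' j') hj
  · obtain ⟨s, hs, h1, h1', h2, h3⟩ := H.sub2 hT Hu Hv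
    obtain ⟨i, hi, hi'⟩ := Finset.exists_of_ssubset (hsub.ssubset_of_ne heq)
    refine ⟨s, 1, zero_le_one, le_rfl, hs, h1, h1', h2, ?_, Or.inr ⟨i, hi', ?_⟩, ?_⟩
    · intro i hi t ht
      exact ⟨hE.trans (h3 i hi t ht), by linarith [h2 i t]⟩
    · intro t ht
      linarith [hE.trans (h3 i hi t ht)]
    · intro i _ j _
      exact min_le_left _ _

lemma aux_sorted {E : Type*} [Fintype E] [Nonempty E] (Y : E → ℝ) :
    ∃ (e : E ≃ Fin (Fintype.card E)) (z : ℕ → ℝ), Monotone z ∧ ∀ ν, Y ν = z (e ν : ℕ) := by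
  classical
  have hN : 0 < Fintype.card E := Fintype.card_pos
  set e0 := Fintype.equivFin E
  set f : Fin (Fintype.card E) → ℝ := fun l => Y (e0.symm l) with hf
  have hm := Tuple.monotone_sort f
  refine ⟨e0.trans (Tuple.sort f).symm, fun l => f (Tuple.sort f ⟨min l (Fintype.card E - 1), by omega⟩),
    ?_, ?_⟩
  · intro l l' hl
    apply hm
    rw [Fin.mk_le_mk]
    omega
  · intro ν
    have : (⟨min ((e0.trans (Tuple.sort f).symm ν : Fin _) : ℕ) (Fintype.card E - 1), by omega⟩ :
        Fin (Fintype.card E)) = (e0.trans (Tuple.sort f).symm) ν := by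
      ext
      have := ((e0.trans (Tuple.sort f).symm) ν).2
      simp only
      omega
    simp only [this]
    simp [hf]

lemma aux_tele (z : ℕ → ℝ) {N l : ℕ} (hl : l < N) :
    z l = z 0 + ∑ k ∈ (Finset.range (N-1)).filter (fun k => 0 < z (k+1) - z k),
      (z (k+1) - z k) * (if k < l then (1:ℝ) else 0) ∨ ¬ Monotone z := by
  by_cases hz : Monotone z
  · left
    rw [Finset.sum_filter_of_ne]
    · have : ∑ k ∈ Finset.range (N-1), (z (k+1) - z k) * (if k < l then (1:ℝ) else 0)
          = ∑ k ∈ Finset.range l, (z (k+1) - z k) := by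
        rw [← Finset.sum_subset (Finset.range_subset_range.2 (show l ≤ N - 1 by omega))]
        · refine Finset.sum_congr rfl fun k hk => ?_
          rw [if_pos (Finset.mem_range.1 hk), mul_one]
        · intro k _ hk
          rw [if_neg (by simpa using hk), mul_zero]
      rw [this, Finset.sum_range_sub]
      ring
    · intro k _ hk
      have h1 : z (k+1) - z k ≠ 0 := left_ne_zero_of_mul hk
      have h2 : 0 ≤ z (k+1) - z k := sub_nonneg.2 (hz (Nat.le_succ k))
      exact lt_of_le_of_ne h2 (Ne.symm h1)
  · right; exact hz

/-- The Lyapunov-type functional. -/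
noncomputable def FF {E : Type*} [Fintype E] [DecidableEq E] (γ : ℝ) (Y : E → ℝ) : ℝ :=
  Finset.univ.inf' (⟨Fintype.equivFin E, Finset.mem_univ _⟩ :
      (Finset.univ : Finset (E ≃ Fin (Fintype.card E))).Nonempty)
    (fun e : E ≃ Fin (Fintype.card E) =>
      ∑ ν, (1 + 1/γ)^(Fintype.card E - 1 - (e ν : ℕ)) * Y ν)

lemma LS.block {b h : V → V → ℝ → ℝ} {hbar T0 : ℝ} {x : V → ℝ → ℝ}
    (H : LS b h hbar T0 x) {t0 T : ℝ} (h0 : T0 ≤ t0) (hT : t0 ≤ T) {K B γ : ℝ} (hK1 : 1 ≤ K)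
    (hK : ∀ i j, i ≠ j → ∫ r in t0..T, b i j r ≤ K * ∫ r in t0..T, b j i r)
    (hB : ∫ r in t0..T, ∑ i, ∑ j, b i j r ≤ B) (hγ : 0 < γ) (hγ1 : γ ≤ Real.exp (-B))
    (hγ2 : γ * (Fintype.card V * K) ≤ Real.exp (-B) * Real.exp (-B))
    (Y Y' : V × Bool → ℝ) (hYt : ∀ i, Y (i, true) = x i t0)
    (hYf : ∀ i, ∀ t ∈ Icc (t0 - hbar) t0, Y (i, false) ≤ x i t)
    (hYt' : ∀ i, Y' (i, true) = x i T)
    (hYf' : ∀ i, ∃ τ ∈ Icc t0 T, Y' (i, false) = x i τ) :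
    ∃ ε : ℝ, 0 ≤ ε ∧ (∀ i, ∀ t ∈ Icc t0 T, x i t0 - ε ≤ x i t) ∧
      FF γ Y + γ * ε ≤ FF γ Y' ∧
      ∀ i j, (Y (j, false) - x i t0) * min 1 (∫ r in t0..T, b j i r) ≤ ε := by
  classical
  have hbar0 := H.hb0
  rcases isEmpty_or_nonempty V with hV | hV
  · refine ⟨0, le_rfl, fun i => (hV.false i).elim, ?_, fun i => (hV.false i).elim⟩
    rw [show Y = Y' from funext fun ν => (hV.false ν.1).elim]
    simp
  set N := Fintype.card (V × Bool) with hN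
  obtain ⟨e, z, hz, hYz⟩ : ∃ (e : V × Bool ≃ Fin N) (z : ℕ → ℝ), Monotone z ∧
    ∀ ν, Y ν = z (e ν : ℕ) := aux_sorted Y
  have hN1 : 0 < N := Fintype.card_pos
  set A := (Finset.range (N-1)).filter (fun k => 0 < z (k+1) - z k) with hA
  set g : ℕ → ℝ := fun k => z (k+1) - z k with hg
  have hY : ∀ ν, Y ν = z 0 + ∑ k ∈ A, g k * (if k < (e ν : ℕ) then (1:ℝ) else 0) := fun ν => by
    rw [hYz]
    exact (aux_tele z (e ν).2).resolve_right (not_not.2 hz)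
  have hAk : ∀ k ∈ A, k + 1 < N ∧ 0 < g k := fun k hk => by
    rw [hA, Finset.mem_filter, Finset.mem_range] at hk
    exact ⟨by omega, hk.2⟩
  set Hu : ℕ → Finset V := fun k => Finset.univ.filter fun i => k < (e (i, false) : ℕ) with hHu
  set Hv : ℕ → Finset V := fun k => Finset.univ.filter fun i => k < (e (i, true) : ℕ) with hHv
  have hsub : ∀ k ∈ A, Hu k ⊆ Hv k := by
    intro k hk i hi
    simp only [hHu, hHv, Finset.mem_filter, Finset.mem_univ, true_and] at hi ⊢
    by_contra hcon
    have h1 : Y (i, true) ≤ z k := by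
      rw [hYz]; exact hz (by omega)
    have h2 : z (k+1) ≤ Y (i, false) := by
      rw [hYz]; exact hz (by omega)
    have h3 : Y (i, false) ≤ Y (i, true) := by
      rw [hYt]; exact hYf i t0 ⟨by linarith, le_rfl⟩
    have h4 := (hAk k hk).2
    simp only [hg] at h4
    linarith
  have hne : ∀ k ∈ A, Hu k ≠ Finset.univ := by
    intro k hk hcon
    have h1 : ∀ ν : V × Bool, k < (e ν : ℕ) := by
      rintro ⟨i, c⟩
      have h2 : i ∈ Hu k := by rw [hcon]; exact Finset.mem_univ i
      have h3 := hsub k hk h2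
      simp only [hHu, hHv, Finset.mem_filter, Finset.mem_univ, true_and] at h2 h3
      cases c
      · exact h2
      · exact h3
    have := h1 (e.symm ⟨0, hN1⟩)
    simp at this
  have hex : ∀ k, ∃ (s : V → ℝ → ℝ) (D : ℝ), k ∈ A → (0 ≤ D ∧ D ≤ 1 ∧ IsSub b h t0 T s ∧
      (∀ i, ∀ t < t0, s i t = if i ∈ Hu k then 1 else 0) ∧
      (∀ i, s i t0 = if i ∈ Hv k then 1 else 0) ∧ (∀ i t, 0 ≤ s i t) ∧
      (∀ i ∈ Hv k, ∀ t ∈ Icc t0 T, Real.exp (-B) ≤ s i t ∧ 1 - D ≤ s i t) ∧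
      ((∃ i, i ∉ Hv k ∧ γ * D ≤ s i T) ∨ (∃ i, i ∉ Hu k ∧ ∀ t ∈ Icc t0 T, γ * D ≤ s i t)) ∧
      (∀ i ∉ Hv k, ∀ j ∈ Hu k, min 1 (∫ r in t0..T, b j i r) ≤ D)) := by
    intro k
    by_cases hk : k ∈ A
    · obtain ⟨s, D, hh⟩ := H.perk h0 hT hK1 hK hB hγ hγ1 hγ2 (Hu k) (Hv k) (hsub k hk) (hne k hk)
      exact ⟨s, D, fun _ => hh⟩
    · exact ⟨fun _ _ => 0, 0, fun hk' => (hk hk').elim⟩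
  choose s D hsD using hex
  have hcomb := IsSub.comb A g (fun k hk => (hAk k hk).2.le) s (fun k hk => (hsD k hk).2.2.1) (z 0)
  have hcmp : ∀ i, ∀ t ∈ Icc t0 T, z 0 + ∑ k ∈ A, g k * s k i t ≤ x i t := by
    refine H.comparison h0 hcomb ?_
    intro i t ht
    rcases ht.2.lt_or_eq with hlt | rfl
    · refine le_trans (le_of_eq ?_) (hYf i t ht)
      rw [hY]
      congr 1
      refine Finset.sum_congr rfl fun k hk => ?_
      rw [(hsD k hk).2.2.2.1 i t hlt]
      simp [hHu]
    · rw [← hYt, hY]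
      refine le_of_eq ?_
      congr 1
      refine Finset.sum_congr rfl fun k hk => ?_
      rw [(hsD k hk).2.2.2.2.1 i]
      simp [hHv]
  refine ⟨∑ k ∈ A, g k * D k,
    Finset.sum_nonneg fun k hk => mul_nonneg (hAk k hk).2.le (hsD k hk).1, ?_, ?_, ?_⟩
  · intro i t ht
    refine le_trans ?_ (hcmp i t ht)
    rw [← hYt, hY, add_sub_assoc, ← Finset.sum_sub_distrib]
    gcongr with k hk
    rw [← mul_sub]
    refine mul_le_mul_of_nonneg_left ?_ (hAk k hk).2.le
    obtain ⟨hD0, hD1, -, -, -, hs0, h7, -, -⟩ := hsD k hk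
    by_cases hi : i ∈ Hv k
    · have : k < (e (i, true) : ℕ) := by simpa [hHv] using hi
      rw [if_pos this]
      exact (h7 i hi t ht).2
    · have : ¬ k < (e (i, true) : ℕ) := by simpa [hHv] using hi
      rw [if_neg this]
      linarith [hs0 i t]
  · have hF1 : FF γ Y ≤ ∑ ν, (1 + 1/γ)^(N - 1 - (e ν : ℕ)) * Y ν :=
      Finset.inf'_le _ (Finset.mem_univ e)
    have hF2 : ∑ ν, (1 + 1/γ)^(N - 1 - (e ν : ℕ)) * Y ν + γ * (∑ k ∈ A, g k * D k) ≤ FF γ Y' := by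
      refine Finset.le_inf' _ _ fun e' _ => ?_
      choose τ hτ hYτ using hYf'
      set σ : ℕ → V × Bool → ℝ := fun k ν => if ν.2 then s k ν.1 T else s k ν.1 (τ ν.1) with hσ
      have hY' : ∀ ν, z 0 + ∑ k ∈ A, g k * σ k ν ≤ Y' ν := by
        rintro ⟨i, c⟩
        cases c
        · rw [hYτ]
          simpa [hσ] using hcmp i (τ i) (hτ i)
        · rw [hYt']
          simpa [hσ] using hcmp i T ⟨hT, le_rfl⟩
      have hkk : ∀ k ∈ A, ∑ ν, (1 + 1/γ)^(N-1-(e ν : ℕ)) * (if k < (e ν : ℕ) then (1:ℝ) else 0)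
          + γ * D k ≤ ∑ ν, (1 + 1/γ)^(N-1-(e' ν : ℕ)) * σ k ν := by
        intro k hk
        obtain ⟨hD0, hD1, -, -, -, hs0, h7, h8, -⟩ := hsD k hk
        have hTT : T ∈ Icc t0 T := ⟨hT, le_rfl⟩
        refine keyK e e' (hAk k hk).1 (σ k) hγ hγ1 hD0 hD1 ?_ ?_ ?_
        · rintro ⟨i, c⟩
          cases c <;> simp [hσ, hs0]
        · rintro ⟨i, c⟩ hi
          have hi' : i ∈ Hv k := by
            cases c
            · exact hsub k hk (by simpa [hHu] using hi)
            · simpa [hHv] using hi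
          cases c
          · simpa [hσ] using h7 i hi' (τ i) (hτ i)
          · simpa [hσ] using h7 i hi' T hTT
        · rcases h8 with ⟨i, hi, hi'⟩ | ⟨i, hi, hi'⟩
          · exact ⟨(i, true), by simpa [hHv] using hi, by simpa [hσ] using hi'⟩
          · exact ⟨(i, false), by simpa [hHu] using hi, by simpa [hσ] using hi' _ (hτ i)⟩
      have hWs : ∑ ν, (1 + 1/γ)^(N-1-(e ν : ℕ)) = ∑ ν, (1 + 1/γ)^(N-1-(e' ν : ℕ)) := by
        rw [Equiv.sum_comp e (fun l : Fin N => (1 + 1/γ)^(N-1-(l : ℕ))),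
          Equiv.sum_comp e' (fun l : Fin N => (1 + 1/γ)^(N-1-(l : ℕ)))]
      calc ∑ ν, (1 + 1/γ)^(N - 1 - (e ν : ℕ)) * Y ν + γ * (∑ k ∈ A, g k * D k)
          = (∑ ν, (1 + 1/γ)^(N - 1 - (e ν : ℕ))) * z 0 + ∑ k ∈ A, g k *
            (∑ ν, (1 + 1/γ)^(N-1-(e ν : ℕ)) * (if k < (e ν : ℕ) then (1:ℝ) else 0) + γ * D k) := by
            simp only [hY, mul_add, Finset.sum_add_distrib, Finset.mul_sum, Finset.sum_mul]
            rw [Finset.sum_comm, add_assoc]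
            congr 2
            · refine Finset.sum_congr rfl fun k _ => Finset.sum_congr rfl fun ν _ => by ring
            · refine Finset.sum_congr rfl fun k _ => by ring
        _ ≤ (∑ ν, (1 + 1/γ)^(N - 1 - (e' ν : ℕ))) * z 0 + ∑ k ∈ A, g k *
            (∑ ν, (1 + 1/γ)^(N-1-(e' ν : ℕ)) * σ k ν) := by
            rw [hWs]
            gcongr with k hk
            · exact (hAk k hk).2.le
            · exact hkk k hk
        _ = ∑ ν, (1 + 1/γ)^(N - 1 - (e' ν : ℕ)) * (z 0 + ∑ k ∈ A, g k * σ k ν) := by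
            simp only [mul_add, Finset.sum_add_distrib, Finset.mul_sum, Finset.sum_mul]
            rw [Finset.sum_comm]
            congr 1
            refine Finset.sum_congr rfl fun k _ => Finset.sum_congr rfl fun ν _ => by ring
        _ ≤ _ := Finset.sum_le_sum fun ν _ =>
            mul_le_mul_of_nonneg_left (hY' ν) (by positivity)
    linarith
  · intro i j
    rw [← hYt, hY (j, false), hY (i, true), add_sub_add_left_eq_sub, ← Finset.sum_sub_distrib,
      Finset.sum_mul]
    refine Finset.sum_le_sum fun k hk => ?_
    rw [← mul_sub, mul_assoc]
    refine mul_le_mul_of_nonneg_left ?_ (hAk k hk).2.le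
    obtain ⟨hD0, hD1, -, -, -, hs0, h7, h8, h9⟩ := hsD k hk
    have hμ : 0 ≤ min 1 (∫ r in t0..T, b j i r) := le_min zero_le_one (H.wnn hT j i)
    by_cases hj : k < (e (j, false) : ℕ) <;> by_cases hi : k < (e (i, true) : ℕ)
    · simp [hi, hj, hD0]
    · rw [if_pos hj, if_neg hi, sub_zero, one_mul]
      exact h9 i (by simpa [hHv] using hi) j (by simpa [hHu] using hj)
    · rw [if_neg hj, if_pos hi]
      linarith
    · simp [hi, hj, hD0]

/-- Block structure. -/
structure Blk (b : V → V → ℝ → ℝ) (hbar T0 : ℝ) (tp : ℕ → ℝ) (B : ℝ) : Prop where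
  h0 : T0 ≤ tp 0
  step : ∀ p, tp p + hbar ≤ tp (p+1)
  mono : Monotone tp
  lim : Tendsto tp atTop atTop
  hB : ∀ p, ∫ r in (tp p)..(tp (p+1)), ∑ i, ∑ j, b i j r ≤ B

lemma Blk.le0 {b : V → V → ℝ → ℝ} {hbar T0 : ℝ} {tp : ℕ → ℝ} {B : ℝ}
    (hb : Blk b hbar T0 tp B) (p : ℕ) : T0 ≤ tp p := hb.h0.trans (hb.mono (Nat.zero_le p))

lemma Blk.find {b : V → V → ℝ → ℝ} {hbar T0 : ℝ} {tp : ℕ → ℝ} {B : ℝ}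
    (hb : Blk b hbar T0 tp B) (P : ℕ) (t : ℝ) (ht : tp P ≤ t) :
    ∃ p, P ≤ p ∧ t ∈ Icc (tp p) (tp (p+1)) := by
  classical
  have hex : ∃ q, t < tp q := (hb.lim.eventually (eventually_gt_atTop t)).exists
  have h1 := Nat.find_spec hex
  have h2 : P < Nat.find hex := by
    by_contra hcon
    have := hb.mono (not_lt.1 hcon)
    linarith
  obtain ⟨q, hq⟩ : ∃ q, Nat.find hex = q + 1 := ⟨Nat.find hex - 1, by omega⟩
  have h3 := Nat.find_min hex (show q < Nat.find hex by omega)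
  rw [hq] at h1
  exact ⟨q, by omega, not_lt.1 h3, h1.le⟩

lemma LS.attain {b h : V → V → ℝ → ℝ} {hbar T0 : ℝ} {x : V → ℝ → ℝ}
    (H : LS b h hbar T0 x) {t0 : ℝ} (h0 : T0 ≤ t0) (i : V) :
    ∃ τ ∈ Icc (t0 - hbar) t0, ∀ t ∈ Icc (t0 - hbar) t0, x i τ ≤ x i t := by
  have := H.hb0
  have hc : ContinuousOn (x i) (Icc (t0 - hbar) t0) :=
    (H.cont i).mono fun t ht => by
      have := ht.1
      simp only [mem_Ici]; linarith
  obtain ⟨τ, hτ, hmin⟩ := isCompact_Icc.exists_isMinOn (nonempty_Icc.2 (by linarith)) hc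
  exact ⟨τ, hτ, fun t ht => hmin ht⟩

lemma LS.bdd1 {b h : V → V → ℝ → ℝ} {hbar T0 : ℝ} {x : V → ℝ → ℝ}
    (H : LS b h hbar T0 x) : ∃ M, ∀ i t, T0 - hbar ≤ t → -M ≤ x i t := by
  choose τ hτ hmin using fun i => H.attain (le_refl T0) i
  refine ⟨∑ i, |x i (τ i)|, H.lower le_rfl ?_⟩
  intro i t ht
  have h1 := hmin i t ht
  have h2 := neg_abs_le (x i (τ i))
  have h3 := Finset.single_le_sum (f := fun i => |x i (τ i)|) (fun _ _ => abs_nonneg _)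
    (Finset.mem_univ i)
  linarith

lemma LS.bdd {b h : V → V → ℝ → ℝ} {hbar T0 : ℝ} {x : V → ℝ → ℝ}
    (H : LS b h hbar T0 x) : ∃ M, ∀ i t, T0 - hbar ≤ t → |x i t| ≤ M := by
  obtain ⟨M, hM⟩ := H.bdd1
  obtain ⟨M', hM'⟩ := H.neg.bdd1
  refine ⟨max M M', fun i t ht => abs_le.2 ⟨?_, ?_⟩⟩
  · linarith [hM i t ht, le_max_left M M']
  · linarith [hM' i t ht, le_max_right M M']

lemma LS.nits1 {b h : V → V → ℝ → ℝ} {hbar T0 : ℝ} {x : V → ℝ → ℝ}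
    (H : LS b h hbar T0 x) {tp : ℕ → ℝ} {B K : ℝ} (hb : Blk b hbar T0 tp B) (hK1 : 1 ≤ K)
    (hK : ∀ p i j, i ≠ j → ∫ r in (tp p)..(tp (p+1)), b i j r
      ≤ K * ∫ r in (tp p)..(tp (p+1)), b j i r) :
    ∃ ε : ℕ → ℝ, Summable ε ∧ ∀ p, 0 ≤ ε p ∧
      (∀ i, ∀ t ∈ Icc (tp p) (tp (p+1)), x i (tp p) - ε p ≤ x i t) ∧
      ∀ i j, ∃ τ ∈ Icc (tp p - hbar) (tp p),
        (x j τ - x i (tp p)) * min 1 (∫ r in (tp p)..(tp (p+1)), b j i r) ≤ ε p := by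
  have hhb := H.hb0
  choose τ hτ hmin using fun p i => H.attain (hb.le0 p) i
  obtain ⟨γ, hγ, hγ1, hγ2⟩ : ∃ γ : ℝ, 0 < γ ∧ γ ≤ Real.exp (-B) ∧
      γ * (Fintype.card V * K) ≤ Real.exp (-B) * Real.exp (-B) := by
    have hpos : 0 < Fintype.card V * K + 1 := by positivity
    refine ⟨min (Real.exp (-B)) (Real.exp (-B) * Real.exp (-B) / (Fintype.card V * K + 1)),
      by positivity, min_le_left _ _, ?_⟩
    calc _ ≤ (Real.exp (-B) * Real.exp (-B) / (Fintype.card V * K + 1)) * (Fintype.card V * K + 1) := by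
          refine mul_le_mul (min_le_right _ _) (by linarith) (by positivity) (by positivity)
      _ = _ := by field_simp
  set Y : ℕ → V × Bool → ℝ := fun p ν => if ν.2 then x ν.1 (tp p) else x ν.1 (τ p ν.1) with hY
  have hblk := fun p => H.block (hb.le0 p) (hb.mono (Nat.le_succ p)) hK1 (hK p) (hb.hB p) hγ hγ1 hγ2
    (Y p) (Y (p+1)) (fun i => by simp [hY]) (fun i t ht => by simpa [hY] using hmin p i t ht)
    (fun i => by simp [hY]) (fun i => ⟨τ (p+1) i, ⟨by linarith [(hτ (p+1) i).1, hb.step p],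
      (hτ (p+1) i).2⟩, by simp [hY]⟩)
  choose ε hε0 hε1 hε2 hε3 using hblk
  obtain ⟨M, hM⟩ := H.bdd
  have hYM : ∀ p ν, Y p ν ≤ M := by
    rintro p ⟨i, c⟩
    have h1 := hb.le0 p
    cases c
    · simp only [hY]
      exact (le_abs_self _).trans (hM i _ (by linarith [(hτ p i).1]))
    · simp only [hY]
      exact (le_abs_self _).trans (hM i _ (by linarith))
  obtain ⟨C, hC⟩ : ∃ C, ∀ p, FF γ (Y p) ≤ C := by
    refine ⟨∑ ν, (1 + 1/γ)^(Fintype.card (V × Bool) - 1 - ((Fintype.equivFin (V × Bool)) ν : ℕ)) * M,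
      fun p => ?_⟩
    refine (Finset.inf'_le _ (Finset.mem_univ (Fintype.equivFin (V × Bool)))).trans ?_
    exact Finset.sum_le_sum fun ν _ => mul_le_mul_of_nonneg_left (hYM p ν) (by positivity)
  refine ⟨ε, ?_, fun p => ⟨hε0 p, hε1 p, fun i j => ⟨τ p j, hτ p j, ?_⟩⟩⟩
  · refine summable_of_sum_range_le (c := (C - FF γ (Y 0)) / γ) hε0 fun n => ?_
    rw [le_div_iff₀ hγ]
    have : ∀ n, FF γ (Y 0) + (∑ p ∈ Finset.range n, ε p) * γ ≤ FF γ (Y n) := by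
      intro n
      induction n with
      | zero => simp
      | succ n ih =>
        rw [Finset.sum_range_succ]
        linarith [hε2 n]
    linarith [this n, hC n]
  · simpa [hY] using hε3 p i j

lemma LS.wle {b h : V → V → ℝ → ℝ} {hbar T0 : ℝ} {x : V → ℝ → ℝ}
    (H : LS b h hbar T0 x) {tp : ℕ → ℝ} {B : ℝ} (hb : Blk b hbar T0 tp B) (p : ℕ) (i j : V) :
    ∫ r in (tp p)..(tp (p+1)), b i j r ≤ B := by
  have hT := hb.mono (Nat.le_succ p)
  refine le_trans ?_ (hb.hB p)
  rw [H.bsum2]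
  refine le_trans (Finset.single_le_sum (f := fun j => ∫ r in (tp p)..(tp (p+1)), b i j r)
    (fun j _ => H.wnn hT i j) (Finset.mem_univ j)) ?_
  exact Finset.single_le_sum (f := fun i => ∑ j, ∫ r in (tp p)..(tp (p+1)), b i j r)
    (fun i _ => Finset.sum_nonneg fun j _ => H.wnn hT i j) (Finset.mem_univ i)

lemma LS.nits_sum {b h : V → V → ℝ → ℝ} {hbar T0 : ℝ} {x : V → ℝ → ℝ}
    (H : LS b h hbar T0 x) {tp : ℕ → ℝ} {B K : ℝ} (hb : Blk b hbar T0 tp B) (hK1 : 1 ≤ K)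
    (hK : ∀ p i j, i ≠ j → ∫ r in (tp p)..(tp (p+1)), b i j r
      ≤ K * ∫ r in (tp p)..(tp (p+1)), b j i r) {i j : V} {ci cj : ℝ}
    (hi : Tendsto (x i) atTop (𝓝 ci)) (hj : Tendsto (x j) atTop (𝓝 cj)) (hlt : ci < cj) :
    Summable fun p => ∫ r in (tp p)..(tp (p+1)), b j i r := by
  obtain ⟨ε, hε, hp⟩ := H.nits1 hb hK1 hK
  have hη : 0 < (cj - ci) / 2 := by linarith
  set η := (cj - ci) / 2 with hηd
  have h1 : ∀ᶠ t in atTop, x i t < ci + η / 2 := hi.eventually (gt_mem_nhds (by linarith))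
  have h2 : ∀ᶠ t in atTop, cj - η / 2 < x j t := hj.eventually (lt_mem_nhds (by linarith))
  obtain ⟨t1, ht1⟩ := eventually_atTop.1 (h1.and h2)
  obtain ⟨P, hP⟩ := eventually_atTop.1 (hb.lim.eventually (eventually_ge_atTop (t1 + hbar)))
  have hhb := H.hb0
  have hw0 : ∀ p, 0 ≤ ∫ r in (tp p)..(tp (p+1)), b j i r := fun p =>
    H.wnn (hb.mono (Nat.le_succ p)) j i
  refine (summable_nat_add_iff P).1 (Summable.of_nonneg_of_le (fun p => hw0 _)
    (f := fun p => (max 1 B / η) * ε (p + P)) (fun p => ?_)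
    (((summable_nat_add_iff P).2 hε).mul_left _))
  obtain ⟨h0, -, h3⟩ := hp (p + P)
  obtain ⟨τ, hτ, hle⟩ := h3 i j
  have h4 := hP (p + P) (by omega)
  have h5 := (ht1 (tp (p+P)) (by linarith)).1
  have h6 := (ht1 τ (by linarith [hτ.1])).2
  set w := ∫ r in (tp (p+P))..(tp (p+P+1)), b j i r with hw
  have hw0' : 0 ≤ w := hw0 (p + P)
  have hwB : w ≤ B := H.wle hb (p + P) j i
  have hμ : 0 ≤ min 1 w := le_min zero_le_one hw0'
  have h7 : η * min 1 w ≤ ε (p + P) :=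
    (mul_le_mul_of_nonneg_right (by linarith) hμ).trans hle
  have h8 : w ≤ max 1 B * min 1 w := by
    rcases le_total 1 w with h | h
    · rw [min_eq_left h, mul_one]
      exact hwB.trans (le_max_right _ _)
    · rw [min_eq_right h]
      nlinarith [le_max_left 1 B]
  calc w ≤ max 1 B * min 1 w := h8
    _ = (max 1 B / η) * (η * min 1 w) := by field_simp
    _ ≤ _ := mul_le_mul_of_nonneg_left h7 (by positivity)

theorem LS.nits {b h : V → V → ℝ → ℝ} {hbar T0 : ℝ} {x : V → ℝ → ℝ}
    (H : LS b h hbar T0 x) {tp : ℕ → ℝ} {B K : ℝ} (hb : Blk b hbar T0 tp B) (hK1 : 1 ≤ K)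
    (hK : ∀ p i j, i ≠ j → ∫ r in (tp p)..(tp (p+1)), b i j r
      ≤ K * ∫ r in (tp p)..(tp (p+1)), b j i r) (i : V) :
    ∃ c, Tendsto (x i) atTop (𝓝 c) := by
  obtain ⟨ε, hε, hp⟩ := H.nits1 hb hK1 hK
  obtain ⟨ε', hε', hp'⟩ := H.neg.nits1 hb hK1 hK
  have hd : ∀ p, ∀ t ∈ Icc (tp p) (tp (p+1)), |x i t - x i (tp p)| ≤ ε p + ε' p := by
    intro p t ht
    have h1 := (hp p).2.1 i t ht
    have h2 := (hp' p).2.1 i t ht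
    have h3 := (hp p).1
    have h4 := (hp' p).1
    rw [abs_le]
    constructor <;> linarith
  have hsum : Summable fun p => ε p + ε' p := hε.add hε'
  have hcs : CauchySeq fun p => x i (tp p) := by
    refine cauchySeq_of_dist_le_of_summable _ (fun p => ?_) hsum
    rw [dist_comm, Real.dist_eq]
    exact hd p _ ⟨hb.mono (Nat.le_succ p), le_rfl⟩
  obtain ⟨c, hc⟩ := cauchySeq_tendsto_of_complete hcs
  refine ⟨c, Metric.tendsto_atTop.2 fun η hη => ?_⟩
  obtain ⟨P1, hP1⟩ := Metric.tendsto_atTop.1 hc (η/2) (by linarith)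
  obtain ⟨P2, hP2⟩ := Metric.tendsto_atTop.1 hsum.tendsto_atTop_zero (η/2) (by linarith)
  refine ⟨tp (max P1 P2), fun t ht => ?_⟩
  obtain ⟨p, hp1, hp2⟩ := hb.find _ t ht
  have h1 := hP1 p ((le_max_left _ _).trans hp1)
  have h2 := hP2 p ((le_max_right _ _).trans hp1)
  have h3 := hd p t hp2
  rw [Real.dist_eq] at h1 h2 ⊢
  have h4 := le_abs_self (ε p + ε' p - 0)
  have h5 := abs_sub_le (x i t) (x i (tp p)) c
  linarith

lemma LS.persist {b h : V → V → ℝ → ℝ} {hbar T0 : ℝ} {x : V → ℝ → ℝ}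
    (H : LS b h hbar T0 x) {t0 T l δ B : ℝ} (h0 : T0 ≤ t0) (hT : t0 ≤ T)
    (hB : ∫ r in t0..T, ∑ i, ∑ j, b i j r ≤ B)
    (hist : ∀ i, ∀ t ∈ Icc (t0 - hbar) t0, l ≤ x i t) (hδ : 0 ≤ δ) (A : Finset V)
    (hA : ∀ i ∈ A, l + δ ≤ x i t0) :
    ∀ i ∈ A, ∀ t ∈ Icc t0 T, l + δ * Real.exp (-B) ≤ x i t := by
  have hE : Real.exp (-B) ≤ Real.exp (-∫ r in t0..T, ∑ i, ∑ j, b i j r) :=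
    Real.exp_le_exp.2 (by linarith)
  obtain ⟨s, hs, h1, h1', h2, h3⟩ := H.sub2 hT ∅ A
  have hc := IsSub.comb (Finset.univ : Finset Unit) (fun _ => δ) (fun _ _ => hδ) (fun _ => s)
    (fun _ _ => hs) l
  have hcmp := H.comparison h0 hc (by
    intro i t ht
    simp only [Finset.univ_unique, Finset.sum_singleton]
    rcases ht.2.lt_or_eq with hlt | rfl
    · rw [h1 i t hlt]
      simpa using hist i t ht
    · rw [h1' i]
      by_cases hi : i ∈ A
      · simpa [hi] using hA i hi
      · simpa [hi] using hist i t ht)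
  intro i hi t ht
  have h4 := hcmp i t ht
  simp only [Finset.univ_unique, Finset.sum_singleton] at h4
  have h5 := mul_le_mul_of_nonneg_left (hE.trans (h3 i hi t ht)) hδ
  linarith

lemma LS.gain {b h : V → V → ℝ → ℝ} {hbar T0 : ℝ} {x : V → ℝ → ℝ}
    (H : LS b h hbar T0 x) {t0 T l δ B ε : ℝ} (h0 : T0 ≤ t0) (hT : t0 ≤ T)
    (hB : ∫ r in t0..T, ∑ i, ∑ j, b i j r ≤ B)
    (hist : ∀ i, ∀ t ∈ Icc (t0 - hbar) t0, l ≤ x i t) (hδ : 0 ≤ δ) (hε : 0 ≤ ε) (A : Finset V)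
    (hA : ∀ i ∈ A, ∀ t ∈ Icc (t0 - hbar) t0, l + δ ≤ x i t) :
    ∀ i ∉ A, (∃ j ∈ A, ε ≤ ∫ r in t0..T, b i j r) →
      l + δ * (Real.exp (-B) * Real.exp (-B) * ε) ≤ x i T := by
  have hE : Real.exp (-B) ≤ Real.exp (-∫ r in t0..T, ∑ i, ∑ j, b i j r) :=
    Real.exp_le_exp.2 (by linarith)
  obtain ⟨s, hs, h1, h2, h3, h4⟩ := H.sub1 h0 hT A
  have hc := IsSub.comb (Finset.univ : Finset Unit) (fun _ => δ) (fun _ _ => hδ) (fun _ => s)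
    (fun _ _ => hs) l
  have hcmp := H.comparison h0 hc (by
    intro i t ht
    simp only [Finset.univ_unique, Finset.sum_singleton]
    rw [h1 i t ht.2]
    by_cases hi : i ∈ A
    · simpa [hi] using hA i hi t ht
    · simpa [hi] using hist i t ht)
  rintro i hi ⟨j, hj, hεj⟩
  have h5 := hcmp i T ⟨hT, le_rfl⟩
  simp only [Finset.univ_unique, Finset.sum_singleton] at h5
  have h6 : ε ≤ ∫ r in t0..T, ∑ j ∈ A, b i j r := by
    rw [H.bsum]
    exact hεj.trans (Finset.single_le_sum (f := fun j => ∫ r in t0..T, b i j r)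
      (fun j _ => H.wnn hT i j) hj)
  have h7 : Real.exp (-B) * Real.exp (-B) * ε ≤ s i T := by
    refine le_trans ?_ (h4 i hi)
    refine mul_le_mul (mul_le_mul hE hE (Real.exp_pos _).le (Real.exp_pos _).le) h6 hε (by positivity)
  have h8 := mul_le_mul_of_nonneg_left h7 hδ
  linarith

lemma LS.step2 {b h : V → V → ℝ → ℝ} {hbar T0 : ℝ} {x : V → ℝ → ℝ}
    (H : LS b h hbar T0 x) {tp : ℕ → ℝ} {B : ℝ} (hb : Blk b hbar T0 tp B) {p : ℕ}
    {l δ ε κ : ℝ} (hδ : 0 ≤ δ) (hε : 0 ≤ ε) (hκ1 : κ ≤ Real.exp (-B) * Real.exp (-B))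
    (hκ2 : κ ≤ Real.exp (-B) * (Real.exp (-B) * Real.exp (-B) * ε))
    (hist : ∀ i t, tp p - hbar ≤ t → l ≤ x i t) (A : Finset V)
    (hA : ∀ i ∈ A, l + δ ≤ x i (tp p)) :
    ∀ i, (i ∈ A ∨ ∃ j ∈ A, ε ≤ ∫ r in (tp (p+1))..(tp (p+2)), b i j r) →
      l + δ * κ ≤ x i (tp (p+2)) := by
  have hhb := H.hb0
  have hst := hb.step p
  have h1 := H.persist (hb.le0 p) (hb.mono (Nat.le_succ p)) (hb.hB p)
    (fun i t ht => hist i t ht.1) hδ A hA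
  have hm1 : tp p ≤ tp (p+1) := hb.mono (Nat.le_succ p)
  have hm2 : tp (p+1) ≤ tp (p+2) := hb.mono (Nat.le_succ (p+1))
  have hδ' : 0 ≤ δ * Real.exp (-B) := by positivity
  have hist' : ∀ i, ∀ t ∈ Icc (tp (p+1) - hbar) (tp (p+1)), l ≤ x i t := fun i t ht =>
    hist i t (by linarith [ht.1])
  intro i hi
  by_cases hiA : i ∈ A
  · have h2 := H.persist (hb.le0 (p+1)) hm2 (hb.hB (p+1)) hist' hδ' A
      (fun i hi => h1 i hi _ ⟨hm1, le_rfl⟩) i hiA (tp (p+2)) ⟨hm2, le_rfl⟩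
    have := mul_le_mul_of_nonneg_left hκ1 hδ
    linarith
  · have h2 := H.gain (hb.le0 (p+1)) hm2 (hb.hB (p+1)) hist' hδ' hε A
      (fun i hi t ht => h1 i hi _ ⟨by linarith [ht.1], ht.2⟩) i hiA (hi.resolve_left hiA)
    have := mul_le_mul_of_nonneg_left hκ2 hδ
    linarith

lemma aux_exit {α : Type*} {r : α → α → Prop} {ρ i : α} (A : Set α) (h : Relation.ReflTransGen r ρ i)
    (hρ : ρ ∈ A) (hi : i ∉ A) : ∃ u v, u ∈ A ∧ v ∉ A ∧ r u v := by
  induction h with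
  | refl => exact (hi hρ).elim
  | @tail u v huv hr ih =>
    by_cases hu : u ∈ A
    · exact ⟨u, v, hu, hi, hr⟩
    · exact ih hu

lemma LS.contract {b h : V → V → ℝ → ℝ} {hbar T0 : ℝ} {x : V → ℝ → ℝ}
    (H : LS b h hbar T0 x) {tp : ℕ → ℝ} {B ε : ℝ} (hb : Blk b hbar T0 tp B) (hε : 0 < ε)
    (hQ : ∀ p, QSCeps ε (fun i j => ∫ r in (tp p)..(tp (p+1)), b i j r)) :
    ∃ η : ℝ, 0 < η ∧ η ≤ 1 ∧ ∀ p l L, l ≤ L →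
      (∀ i, ∀ t ∈ Icc (tp p - hbar) (tp p), l ≤ x i t ∧ x i t ≤ L) →
      ∃ q l' L', p < q ∧ l' ≤ L' ∧ L' - l' ≤ (1 - η) * (L - l) ∧
        (∀ i, ∀ t ∈ Icc (tp q - hbar) (tp q), l' ≤ x i t ∧ x i t ≤ L') := by
  classical
  have hhb := H.hb0
  have hB0 : 0 ≤ B := by
    refine le_trans ?_ (hb.hB 0)
    rw [H.bsum2]
    exact Finset.sum_nonneg fun i _ => Finset.sum_nonneg fun j _ =>
      H.wnn (hb.mono (Nat.le_succ 0)) i j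
  have hβ1 : Real.exp (-B) ≤ 1 := Real.exp_le_one_iff.2 (by linarith)
  have hβ0 := Real.exp_pos (-B)
  set β := Real.exp (-B) with hβ
  obtain ⟨κ, hκ0, hκ1, hκ2, hκ3⟩ : ∃ κ : ℝ, 0 < κ ∧ κ ≤ β * β ∧ κ ≤ β * (β * β * ε) ∧ κ ≤ 1 :=
    ⟨min (β * β) (β * (β * β * ε)), by positivity, min_le_left _ _, min_le_right _ _,
      (min_le_left _ _).trans (by nlinarith)⟩
  set n := Fintype.card V with hn
  have hκn : κ ^ n ≤ 1 := pow_le_one₀ hκ0.le hκ3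
  have hκn0 : 0 < κ ^ n := by positivity
  have hη1 : κ ^ n * β ≤ 1 := by nlinarith
  refine ⟨κ ^ n * β / 2, by positivity, by linarith, ?_⟩
  intro p l L hlL hist
  set δ := (L - l) / 2 with hδ
  have hδ0 : 0 ≤ δ := by rw [hδ]; linarith
  have hlow := H.lower (hb.le0 p) (fun i t ht => (hist i t ht).1)
  have hup := H.neg.lower (m := -L) (hb.le0 p) (fun i t ht => by linarith [(hist i t ht).2])
  have key : ∀ r, ∃ A C : Finset V, (∀ i ∈ A, l + δ * κ ^ r ≤ x i (tp (p + 2 * r))) ∧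
      (∀ i ∈ C, -L + δ * κ ^ r ≤ - x i (tp (p + 2 * r))) ∧ (∀ i, i ∈ A ∨ i ∈ C) ∧
      (A = Finset.univ ∨ C = Finset.univ ∨ n + r ≤ A.card + C.card) := by
    intro r
    induction r with
    | zero =>
      refine ⟨Finset.univ.filter fun i => l + δ ≤ x i (tp p),
        Finset.univ.filter fun i => -L + δ ≤ - x i (tp p), by simp, by simp, ?_, ?_⟩
      · intro i
        simp only [Finset.mem_filter, Finset.mem_univ, true_and]
        by_contra hcon
        push Not at hcon
        rw [hδ] at hcon
        linarith [hcon.1, hcon.2]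
      · right; right
        rw [add_zero, hn, ← Finset.card_univ]
        refine (Finset.card_le_card ?_).trans (Finset.card_union_le _ _)
        intro i _
        simp only [Finset.mem_union, Finset.mem_filter, Finset.mem_univ, true_and]
        by_contra hcon
        push Not at hcon
        rw [hδ] at hcon
        linarith [hcon.1, hcon.2]
    | succ r ih =>
      obtain ⟨A, C, hA, hC, hAC, hcard⟩ := ih
      have hm : tp p ≤ tp (p + 2 * r) := hb.mono (by omega)
      have hδr : 0 ≤ δ * κ ^ r := by positivity
      have hA' := H.step2 hb hδr hε.le hκ1 hκ2 (p := p + 2 * r)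
        (fun i t ht => hlow i t (by linarith)) A hA
      have hC' := H.neg.step2 hb hδr hε.le hκ1 hκ2 (p := p + 2 * r)
        (fun i t ht => hup i t (by linarith)) C hC
      have e1 : p + 2 * r + 2 = p + 2 * (r + 1) := by ring
      have e2 : δ * κ ^ r * κ = δ * κ ^ (r + 1) := by ring
      rw [e1, e2] at hA' hC'
      by_cases hAu : A = Finset.univ
      · exact ⟨A, C, fun i hi => hA' i (Or.inl hi), fun i hi => hC' i (Or.inl hi), hAC, Or.inl hAu⟩
      by_cases hCu : C = Finset.univ
      · exact ⟨A, C, fun i hi => hA' i (Or.inl hi), fun i hi => hC' i (Or.inl hi), hAC,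
          Or.inr (Or.inl hCu)⟩
      have hcard' := (hcard.resolve_left hAu).resolve_left hCu
      obtain ⟨ρ, hρ⟩ := hQ (p + 2 * r + 1)
      have e3 : p + 2 * r + 1 + 1 = p + 2 * (r + 1) := by ring
      rw [e3] at hρ
      rcases hAC ρ with hρA | hρC
      · obtain ⟨i, hi⟩ : ∃ i, i ∉ A := by
          by_contra hcon
          push Not at hcon
          exact hAu (Finset.eq_univ_iff_forall.2 hcon)
        obtain ⟨u, v, hu, hv, huv⟩ := aux_exit (A : Set V) (hρ i) (by simpa using hρA)
          (by simpa using hi)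
        have hv' : v ∉ A := by simpa using hv
        refine ⟨insert v A, C, ?_, fun i hi => hC' i (Or.inl hi), ?_, ?_⟩
        · intro i hi
          rcases Finset.mem_insert.1 hi with rfl | hi
          · exact hA' _ (Or.inr ⟨u, by simpa using hu, huv⟩)
          · exact hA' i (Or.inl hi)
        · intro i
          exact (hAC i).imp_left fun h => Finset.mem_insert_of_mem h
        · right; right
          rw [Finset.card_insert_of_notMem hv']
          omega
      · obtain ⟨i, hi⟩ : ∃ i, i ∉ C := by
          by_contra hcon
          push Not at hcon
          exact hCu (Finset.eq_univ_iff_forall.2 hcon)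
        obtain ⟨u, v, hu, hv, huv⟩ := aux_exit (C : Set V) (hρ i) (by simpa using hρC)
          (by simpa using hi)
        have hv' : v ∉ C := by simpa using hv
        refine ⟨A, insert v C, fun i hi => hA' i (Or.inl hi), ?_, ?_, ?_⟩
        · intro i hi
          rcases Finset.mem_insert.1 hi with rfl | hi
          · exact hC' _ (Or.inr ⟨u, by simpa using hu, huv⟩)
          · exact hC' i (Or.inl hi)
        · intro i
          exact (hAC i).imp_right fun h => Finset.mem_insert_of_mem h
        · right; right
          rw [Finset.card_insert_of_notMem hv']
          omega
  obtain ⟨A, C, hA, hC, -, hcard⟩ := key n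
  have hfin : A = Finset.univ ∨ C = Finset.univ := by
    rcases hcard with h | h | h
    · exact Or.inl h
    · exact Or.inr h
    · left
      have h1 := Finset.card_le_univ A
      have h2 := Finset.card_le_univ C
      rw [← Finset.card_eq_iff_eq_univ]
      omega
  have hm : tp p ≤ tp (p + 2 * n) := hb.mono (by omega)
  have hm1 := hb.step (p + 2 * n)
  have hδn : 0 ≤ δ * κ ^ n := by positivity
  rcases hfin with rfl | rfl
  · have h1 := H.persist (hb.le0 (p + 2 * n)) (hb.mono (Nat.le_succ _)) (hb.hB (p + 2 * n))
      (fun i t ht => hlow i t (by linarith [ht.1])) hδn _ hA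
    refine ⟨p + 2 * n + 1, l + δ * κ ^ n * β, L, by omega, ?_, ?_, ?_⟩
    · rw [hδ]; nlinarith
    · rw [hδ]; linarith
    · intro i t ht
      exact ⟨h1 i (Finset.mem_univ i) t ⟨by linarith [ht.1], ht.2⟩,
        by linarith [hup i t (by linarith [ht.1])]⟩
  · have h1 := H.neg.persist (hb.le0 (p + 2 * n)) (hb.mono (Nat.le_succ _)) (hb.hB (p + 2 * n))
      (fun i t ht => hup i t (by linarith [ht.1])) hδn _ hC
    refine ⟨p + 2 * n + 1, l, L - δ * κ ^ n * β, by omega, ?_, ?_, ?_⟩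
    · rw [hδ]; nlinarith
    · rw [hδ]; linarith
    · intro i t ht
      exact ⟨hlow i t (by linarith [ht.1]),
        by linarith [h1 i (Finset.mem_univ i) t ⟨by linarith [ht.1], ht.2⟩]⟩

theorem LS.aqsc {b h : V → V → ℝ → ℝ} {hbar T0 : ℝ} {x : V → ℝ → ℝ}
    (H : LS b h hbar T0 x) {tp : ℕ → ℝ} {B ε : ℝ} (hb : Blk b hbar T0 tp B) (hε : 0 < ε)
    (hQ : ∀ p, QSCeps ε (fun i j => ∫ r in (tp p)..(tp (p+1)), b i j r)) :
    ∃ c, ∀ i, Tendsto (x i) atTop (𝓝 c) := by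
  obtain ⟨η, hη0, hη1, hstep⟩ := H.contract hb hε hQ
  obtain ⟨M, hM⟩ := H.bdd
  obtain ⟨i0, -⟩ := hQ 0
  have hM0 : 0 ≤ M := (abs_nonneg _).trans (hM i0 T0 (by linarith [H.hb0]))
  have hr : ∀ r : ℕ, ∃ q l L, l ≤ L ∧ L - l ≤ (1 - η) ^ r * (2 * M) ∧
      (∀ i, ∀ t ∈ Icc (tp q - hbar) (tp q), l ≤ x i t ∧ x i t ≤ L) := by
    intro r
    induction r with
    | zero =>
      refine ⟨0, -M, M, by linarith, by linarith, fun i t ht => ?_⟩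
      exact abs_le.1 (hM i t (by linarith [ht.1, hb.h0]))
    | succ r ih =>
      obtain ⟨q, l, L, h1, h2, h3⟩ := ih
      obtain ⟨q', l', L', -, h4, h5, h6⟩ := hstep q l L h1 h3
      refine ⟨q', l', L', h4, h5.trans ?_, h6⟩
      rw [pow_succ]
      nlinarith
  have hosc : ∀ e > 0, ∃ T, ∀ i j, ∀ s ≥ T, ∀ t ≥ T, dist (x i s) (x j t) < e := by
    intro e he
    have hlim : Tendsto (fun r : ℕ => (1 - η) ^ r * (2 * M)) atTop (𝓝 (0 * (2 * M))) :=
      (tendsto_pow_atTop_nhds_zero_of_lt_one (by linarith) (by linarith)).mul_const _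
    rw [zero_mul] at hlim
    obtain ⟨r, hr'⟩ := (hlim.eventually (gt_mem_nhds he)).exists
    obtain ⟨q, l, L, h1, h2, h3⟩ := hr r
    have hlow := H.lower (hb.le0 q) (fun i t ht => (h3 i t ht).1)
    have hup := H.neg.lower (m := -L) (hb.le0 q) (fun i t ht => by linarith [(h3 i t ht).2])
    refine ⟨tp q - hbar, fun i j s hs t ht => ?_⟩
    have a1 := hlow i s hs
    have a2 := hlow j t ht
    have a3 := hup i s hs
    have a4 := hup j t ht
    rw [Real.dist_eq, abs_lt]
    constructor <;> linarith
  have hcs : CauchySeq (x i0) := by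
    rw [Metric.cauchySeq_iff']
    intro e he
    obtain ⟨T, hT⟩ := hosc e he
    exact ⟨T, fun t ht => hT i0 i0 t ht T le_rfl⟩
  obtain ⟨c, hc⟩ := cauchySeq_tendsto_of_complete hcs
  refine ⟨c, fun i => Metric.tendsto_atTop.2 fun e he => ?_⟩
  obtain ⟨T, hT⟩ := hosc (e/2) (by linarith)
  obtain ⟨T', hT'⟩ := Metric.tendsto_atTop.1 hc (e/2) (by linarith)
  refine ⟨max T T', fun t ht => ?_⟩
  have h1 := hT i i0 t ((le_max_left _ _).trans ht) t ((le_max_left _ _).trans ht)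
  have h2 := hT' t ((le_max_right _ _).trans ht)
  linarith [dist_triangle (x i t) (x i0 t) c]

lemma Weights.ii {a : V → V → ℝ → ℝ} (hW : Weights a) {i j : V} (hij : i ≠ j) {s t : ℝ}
    (hs : 0 ≤ s) (ht : 0 ≤ t) : IntervalIntegrable (a i j) volume s t := by
  have h := (hW i j hij).2.2 (max s t)
  rw [intervalIntegrable_iff]
  refine h.mono_set fun r hr => ?_
  have h1 := hr.1
  have h2 := hr.2
  exact ⟨(le_min hs ht).trans h1.le, h2⟩

lemma Weights.mono {a : V → V → ℝ → ℝ} (hW : Weights a) {i j : V} (hij : i ≠ j) {s s' t t' : ℝ}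
    (hs : 0 ≤ s) (h1 : s ≤ s') (h2 : s' ≤ t') (h3 : t' ≤ t) :
    ∫ r in s'..t', a i j r ≤ ∫ r in s..t, a i j r := by
  refine intervalIntegral.integral_mono_interval h1 h2 h3 ?_ (hW.ii hij hs (by linarith))
  refine (ae_restrict_iff' measurableSet_Ioc).2 (Eventually.of_forall fun r hr => ?_)
  exact (hW i j hij).2.1 r (by linarith [hr.1])

lemma Weights.wnn {a : V → V → ℝ → ℝ} (hW : Weights a) {i j : V} (hij : i ≠ j) {s t : ℝ}
    (hs : 0 ≤ s) (h1 : s ≤ t) : 0 ≤ ∫ r in s..t, a i j r :=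
  intervalIntegral.integral_nonneg h1 fun r hr => (hW i j hij).2.1 r (hs.trans hr.1)

lemma grouping {a : V → V → ℝ → ℝ} (hW : Weights a) (hU : ULI a) {tp : ℕ → ℝ} (hI : IncrSeq tp)
    (hbd : tpBounded a tp) {hbar : ℝ} (hh : 0 ≤ hbar) (T0 : ℝ) :
    ∃ (q : ℕ → ℕ) (L : ℝ), StrictMono q ∧ T0 ≤ tp (q 0) ∧ (∀ r, tp (q r) + hbar ≤ tp (q (r+1))) ∧
      ∀ r i j, i ≠ j → ∫ s in (tp (q r))..(tp (q (r+1))), a i j s ≤ L := by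
  classical
  obtain ⟨hm, hl, h0⟩ := hI
  obtain ⟨L, hL⟩ := hbd
  obtain ⟨M, hM⟩ := hU (hbar + 1) (by linarith)
  have hpos : ∀ n, 0 ≤ tp n := fun n => h0.trans (hm.monotone (Nat.zero_le n))
  have hnx : ∀ n, ∃ k, n < k ∧ tp n + hbar ≤ tp k ∧
      ∀ i j, i ≠ j → ∫ s in (tp n)..(tp k), a i j s ≤ M + L := by
    intro n
    have hex : ∃ k, n < k ∧ tp n + hbar ≤ tp k :=
      ((eventually_gt_atTop n).and (hl.eventually (eventually_ge_atTop (tp n + hbar)))).exists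
    obtain ⟨h1, h2⟩ := Nat.find_spec hex
    refine ⟨Nat.find hex, h1, h2, fun i j hij => ?_⟩
    obtain ⟨k, hk⟩ : ∃ k, Nat.find hex = k + 1 := ⟨Nat.find hex - 1, by omega⟩
    have h3 := Nat.find_min hex (show k < Nat.find hex by omega)
    have hnk : n ≤ k := by omega
    have h4 : tp k ≤ tp n + (hbar + 1) := by
      rcases hnk.eq_or_lt with rfl | hlt
      · linarith
      · have : ¬ tp n + hbar ≤ tp k := fun hc => h3 ⟨hlt, hc⟩
        linarith
    rw [hk, ← intervalIntegral.integral_add_adjacent_intervals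
      (hW.ii hij (hpos n) (hpos k)) (hW.ii hij (hpos k) (hpos (k+1)))]
    refine add_le_add ?_ (hL k i j hij)
    exact (hW.mono hij (hpos n) le_rfl (hm.monotone hnk) h4).trans (hM (tp n) (hpos n) i j hij)
  choose nx hn1 hn2 hn3 using hnx
  obtain ⟨n0, hn0⟩ := (hl.eventually (eventually_ge_atTop T0)).exists
  refine ⟨fun r => Nat.rec n0 (fun _ k => nx k) r, M + L, ?_, hn0, fun r => hn2 _, fun r => hn3 _⟩
  exact strictMono_nat_of_lt_succ fun r => hn1 _

lemma nits_group {a : V → V → ℝ → ℝ} (hW : Weights a) {tp : ℕ → ℝ} (hI : IncrSeq tp) {K : ℝ}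
    {i j : V} (hij : i ≠ j) (hK : ∀ p, ∫ s in (tp p)..(tp (p+1)), a i j s ≤
      K * ∫ s in (tp p)..(tp (p+1)), a j i s) {n k : ℕ} (hnk : n ≤ k) :
    ∫ s in (tp n)..(tp k), a i j s ≤ K * ∫ s in (tp n)..(tp k), a j i s := by
  have hpos : ∀ n, 0 ≤ tp n := fun n => hI.2.2.trans (hI.1.monotone (Nat.zero_le n))
  induction k, hnk using Nat.le_induction with
  | base => simp
  | succ k hk ih =>
    rw [← intervalIntegral.integral_add_adjacent_intervals
      (hW.ii hij (hpos n) (hpos k)) (hW.ii hij (hpos k) (hpos (k+1))),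
      ← intervalIntegral.integral_add_adjacent_intervals
      (hW.ii hij.symm (hpos n) (hpos k)) (hW.ii hij.symm (hpos k) (hpos (k+1))), mul_add]
    exact add_le_add ih (hK k)

lemma aux_rtg {α : Type*} {r r' : α → α → Prop} (h : ∀ u v, u ≠ v → r u v → r' u v) {u v : α}
    (huv : Relation.ReflTransGen r u v) : Relation.ReflTransGen r' u v := by
  induction huv with
  | refl => exact Relation.ReflTransGen.refl
  | @tail p q _ hpq ih =>
    by_cases hne : p = q
    · exact hne ▸ ih
    · exact ih.tail (h p q hne hpq)

/-- Transferring the block structure to equivalent weights. -/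
lemma blk_transfer {a b h : V → V → ℝ → ℝ} {hbar T0 : ℝ} {x : V → ℝ → ℝ} {C L : ℝ}
    (hW : Weights a) (H : LS b h hbar T0 x) (hT0 : 0 ≤ T0) (hC : 0 ≤ C)
    (hbd : ∀ i s, b i i s = 0)
    (hba : ∀ i j, i ≠ j → ∀ s ≥ T0, b i j s ≤ C * a i j s) {tq : ℕ → ℝ} (h0 : T0 ≤ tq 0)
    (hst : ∀ r, tq r + hbar ≤ tq (r+1)) (hl : Tendsto tq atTop atTop)
    (hL : ∀ r i j, i ≠ j → ∫ s in (tq r)..(tq (r+1)), a i j s ≤ L) :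
    Blk b hbar T0 tq (Fintype.card V * (Fintype.card V * |C * L|)) := by
  have hhb := H.hb0
  have hm : Monotone tq := monotone_nat_of_le_succ fun r => by linarith [hst r]
  refine ⟨h0, hst, hm, hl, fun r => ?_⟩
  have hr : T0 ≤ tq r := h0.trans (hm (Nat.zero_le r))
  have hr1 : tq r ≤ tq (r+1) := hm (Nat.le_succ r)
  rw [H.bsum2]
  have h1 : ∀ i j, ∫ s in (tq r)..(tq (r+1)), b i j s ≤ |C * L| := by
    intro i j
    by_cases hij : i = j
    · subst hij
      rw [show b i i = fun _ => 0 from funext (hbd i), intervalIntegral.integral_zero]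
      exact abs_nonneg _
    · calc ∫ s in (tq r)..(tq (r+1)), b i j s ≤ ∫ s in (tq r)..(tq (r+1)), C * a i j s := by
            refine intervalIntegral.integral_mono_on hr1 (H.bint i j _ _)
              ((hW.ii hij (by linarith) (by linarith)).const_mul C) fun s hs => ?_
            exact hba i j hij s (hr.trans hs.1)
        _ = C * ∫ s in (tq r)..(tq (r+1)), a i j s := by rw [intervalIntegral.integral_const_mul]
        _ ≤ C * L := mul_le_mul_of_nonneg_left (hL r i j hij) hC
        _ ≤ _ := le_abs_self _
  calc _ ≤ ∑ i : V, ∑ j : V, |C * L| := Finset.sum_le_sum fun i _ => Finset.sum_le_sum fun j _ => h1 i j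
    _ = _ := by simp

lemma aux_cont {m : ℕ} {a h : V → V → ℝ → ℝ} {ψ : V → V → (Fin m → ℝ) → (Fin m → ℝ) → ℝ}
    {hbar tstar : ℝ} {x : ℝ → V → (Fin m → ℝ)} (hx : IsSolN m a h ψ hbar tstar x) (i : V) :
    ContinuousOn (fun t => x t i) (Ici tstar) := by
  intro t ht
  have ht' : tstar ≤ t := ht
  have h1 := ((hx.2.2 i (t+1) (by linarith : tstar ≤ t + 1)).1)
  have h2 := intervalIntegral.continuousOn_primitive_interval' h1 left_mem_uIcc
  rw [uIcc_of_le (by linarith)] at h2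
  have h3 : ContinuousOn (fun t => x t i) (Icc tstar (t+1)) := by
    refine ((continuousOn_const (c := x tstar i)).add h2).congr fun s hs => ?_
    exact (hx.2.2 i s hs.1).2
  refine (h3 t ⟨ht', by linarith⟩).mono_of_mem_nhdsWithin ?_
  rw [← Ici_inter_Iic]
  exact inter_mem self_mem_nhdsWithin (mem_nhdsWithin_of_mem_nhds (Iic_mem_nhds (by linarith)))

lemma reduction {m : ℕ} {a h : V → V → ℝ → ℝ} {ψ : V → V → (Fin m → ℝ) → (Fin m → ℝ) → ℝ}
    {hbar tstar : ℝ} {x : ℝ → V → (Fin m → ℝ)} (hW : Weights a)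
    (hψc : ∀ i j : V, Continuous (fun p : (Fin m → ℝ) × (Fin m → ℝ) => ψ i j p.1 p.2))
    (hψb : ∀ i j : V, ∀ Ω : Set ((Fin m → ℝ) × (Fin m → ℝ)), IsCompact Ω →
      (∃ c > (0:ℝ), ∀ p ∈ Ω, c ≤ ψ i j p.1 p.2) ∧ (∃ C : ℝ, ∀ p ∈ Ω, ψ i j p.1 p.2 ≤ C))
    (hb0 : 0 ≤ hbar) (hd : Delays h hbar) (hts : 0 ≤ tstar) (hx : IsSolN m a h ψ hbar tstar x) :
    ∃ (b : V → V → ℝ → ℝ) (c C : ℝ), 0 < c ∧ c ≤ C ∧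
      (∀ k, LS b h hbar (tstar + hbar) (fun i t => x t i k)) ∧
      (∀ i s, b i i s = 0) ∧
      ∀ i j, i ≠ j → ∀ s ≥ tstar + hbar, c * a i j s ≤ b i j s ∧ b i j s ≤ C * a i j s := by
  classical
  have hψ0 : ∀ i j y z, 0 < ψ i j y z := fun i j y z => by
    obtain ⟨⟨c, hc, h1⟩, -⟩ := hψb i j {(y, z)} isCompact_singleton
    exact hc.trans_le (h1 (y, z) rfl)
  set T0 := tstar + hbar with hT0
  have hT00 : 0 ≤ T0 := by linarith
  have hxt : ∀ j, Continuous fun s => x (max s tstar) j := fun j =>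
    (aux_cont hx j).comp_continuous (continuous_id.max continuous_const) fun s =>
      mem_Ici.2 (le_max_right _ _)
  set b : V → V → ℝ → ℝ := fun i j s =>
    if i ≠ j ∧ T0 ≤ s then a i j s * ψ i j (x (s - h i j s) j) (x s i) else 0 with hb
  have hbnn : ∀ i j s, 0 ≤ b i j s := by
    intro i j s
    simp only [hb]
    split_ifs with hc
    · exact mul_nonneg ((hW i j hc.1).2.1 s (by linarith [hc.2])) (hψ0 _ _ _ _).le
    · exact le_rfl
  have hbii : ∀ i s, b i i s = 0 := fun i s => by simp [hb]
  have hbij : ∀ i j, i ≠ j → ∀ s ≥ T0, b i j s = a i j s * ψ i j (x (s - h i j s) j) (x s i) := by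
    intro i j hij s hs
    simp only [hb]
    rw [if_pos ⟨hij, hs⟩]
  have hhd : ∀ i j s, T0 ≤ s → 0 ≤ h i j s ∧ h i j s ≤ hbar := fun i j s hs =>
    (hd i j).2 s (hT00.trans hs)
  have hbint : ∀ i j t1 t2, IntervalIntegrable (b i j) volume t1 t2 := by
    intro i j t1 t2
    by_cases hij : i = j
    · subst hij
      rw [show b i i = fun _ => 0 from funext (hbii i)]
      simp
    have hbind : b i j = (Ici T0).indicator fun s =>
        a i j s * ψ i j (x (max (s - h i j s) tstar) j) (x (max s tstar) i) := by
      ext s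
      by_cases hs : T0 ≤ s
      · rw [indicator_of_mem (show s ∈ Ici T0 from hs), hbij i j hij s hs,
          max_eq_left (show tstar ≤ s - h i j s by linarith [(hhd i j s hs).2]),
          max_eq_left (show tstar ≤ s by linarith)]
      · rw [indicator_of_notMem (show s ∉ Ici T0 from hs)]
        simp [hb, hs]
    have hmeas : Measurable (b i j) := by
      rw [hbind]
      refine Measurable.indicator ?_ measurableSet_Ici
      refine (hW i j hij).1.mul ?_
      refine (hψc i j).measurable.comp (Measurable.prodMk ?_ (hxt i).measurable)
      exact (hxt j).measurable.comp (measurable_id.sub (hd i j).1)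
    set T := max t1 t2 with hT
    have hcomp : ∀ j, IsCompact ((fun s => x (max s tstar) j) '' Icc tstar T) := fun j =>
      isCompact_Icc.image (hxt j)
    obtain ⟨-, C, hC⟩ := hψb i j _ ((hcomp j).prod (hcomp i))
    have hInt : IntegrableOn (b i j) (Iic T) := by
      have hg : Integrable ((Icc 0 T).indicator fun s => |C| * a i j s) :=
        (integrable_indicator_iff measurableSet_Icc).2 (((hW i j hij).2.2 T).const_mul _)
      refine Integrable.mono' hg.integrableOn hmeas.aestronglyMeasurable ?_
      refine (ae_restrict_iff' measurableSet_Iic).2 (Eventually.of_forall fun s hs => ?_)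
      rw [Real.norm_of_nonneg (hbnn i j s)]
      have hs' : s ≤ T := hs
      by_cases hs0 : T0 ≤ s
      · rw [indicator_of_mem (show s ∈ Icc 0 T from ⟨hT00.trans hs0, hs⟩), hbij i j hij s hs0,
          mul_comm]
        refine mul_le_mul_of_nonneg_right ?_ ((hW i j hij).2.1 s (hT00.trans hs0))
        refine le_trans ?_ (le_abs_self C)
        have h1 := hhd i j s hs0
        refine hC (x (s - h i j s) j, x s i) ⟨⟨s - h i j s, ⟨by linarith, by linarith⟩, ?_⟩,
          ⟨s, ⟨by linarith, hs⟩, ?_⟩⟩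
        · simp only
          rw [max_eq_left (show tstar ≤ s - h i j s by linarith)]
        · simp only
          rw [max_eq_left (show tstar ≤ s by linarith)]
      · rw [show b i j s = 0 by simp [hb, hs0]]
        by_cases h1 : s ∈ Icc 0 T
        · rw [indicator_of_mem h1]
          exact mul_nonneg (abs_nonneg _) ((hW i j hij).2.1 s h1.1)
        · rw [indicator_of_notMem h1]
    rw [intervalIntegrable_iff]
    exact hInt.mono_set fun s hs => hs.2
  have hrhs : ∀ i k s, T0 ≤ s → rhsN m a h ψ x i s k =
      ∑ j, b i j s * (x (s - h i j s) j k - x s i k) := by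
    intro i k s hs
    rw [rhsN, Finset.sum_apply, ← Finset.sum_erase_add _ _ (Finset.mem_univ i), hbii, zero_mul,
      add_zero]
    refine Finset.sum_congr rfl fun j hj => ?_
    rw [hbij i j (Finset.ne_of_mem_erase hj).symm s hs]
    simp
  have hLS : ∀ k, LS b h hbar T0 (fun i t => x t i k) := by
    intro k
    have hI : ∀ i t1 t2, T0 ≤ t1 → t1 ≤ t2 → IntervalIntegrable (rhsN m a h ψ x i) volume t1 t2 :=
      fun i t1 t2 h1 h2 => ((hx.2.2 i t1 (show tstar ≤ t1 by linarith)).1.symm).trans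
        (hx.2.2 i t2 (show tstar ≤ t2 by linarith)).1
    have hIk : ∀ i t1 t2, T0 ≤ t1 → t1 ≤ t2 →
        IntervalIntegrable (fun s => rhsN m a h ψ x i s k) volume t1 t2 := by
      intro i t1 t2 h1 h2
      have := hI i t1 t2 h1 h2
      exact ⟨(ContinuousLinearMap.proj (R := ℝ) (φ := fun _ : Fin m => ℝ) k).integrable_comp this.1,
        (ContinuousLinearMap.proj (R := ℝ) (φ := fun _ : Fin m => ℝ) k).integrable_comp this.2⟩
    refine ⟨hb0, hbnn, hbint, hhd, ?_, ?_, ?_⟩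
    · intro i
      have : T0 - hbar = tstar := by rw [hT0]; ring
      rw [this]
      exact (continuous_apply k).comp_continuousOn (aux_cont hx i)
    · intro i t1 t2 h1 h2
      refine (hIk i t1 t2 h1 h2).congr ?_
      intro s hs
      rw [uIoc_of_le h2] at hs
      exact hrhs i k s (h1.trans hs.1.le)
    · intro i t1 t2 h1 h2
      have e1 := (hx.2.2 i t1 (show tstar ≤ t1 by linarith))
      have e2 := (hx.2.2 i t2 (show tstar ≤ t2 by linarith))
      have e3 : x t2 i - x t1 i = ∫ s in t1..t2, rhsN m a h ψ x i s := by
        rw [e1.2, e2.2, ← intervalIntegral.integral_interval_sub_left e2.1 e1.1]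
        abel
      have e4 := congrFun e3 k
      have e5 := (ContinuousLinearMap.proj (R := ℝ) (φ := fun _ : Fin m => ℝ) k).intervalIntegral_comp_comm
        (hI i t1 t2 h1 h2)
      simp only [ContinuousLinearMap.proj_apply] at e5
      rw [← e5] at e4
      rw [Pi.sub_apply] at e4
      rw [e4]
      refine intervalIntegral.integral_congr fun s hs => ?_
      rw [uIcc_of_le h2] at hs
      exact hrhs i k s (h1.trans hs.1)
  choose M hM using fun k => (hLS k).bdd
  have hMb : ∀ i t, tstar ≤ t → x t i ∈ Metric.closedBall (0 : Fin m → ℝ) (∑ k, |M k|) := by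
    intro i t ht
    rw [mem_closedBall_zero_iff, pi_norm_le_iff_of_nonneg (Finset.sum_nonneg fun _ _ => abs_nonneg _)]
    intro k
    rw [Real.norm_eq_abs]
    refine (hM k i t (by rw [hT0]; linarith)).trans ((le_abs_self _).trans ?_)
    exact Finset.single_le_sum (f := fun k => |M k|) (fun _ _ => abs_nonneg _) (Finset.mem_univ k)
  have hcb := isCompact_closedBall (0 : Fin m → ℝ) (∑ k, |M k|)
  choose c hc0 hc using fun p : V × V => (hψb p.1 p.2 _ (hcb.prod hcb)).1
  choose C hC using fun p : V × V => (hψb p.1 p.2 _ (hcb.prod hcb)).2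
  obtain ⟨c', hc'0, hc'⟩ : ∃ c' > 0, ∀ p, c' ≤ c p := by
    rcases isEmpty_or_nonempty (V × V) with hE | hE
    · exact ⟨1, one_pos, fun p => (hE.false p).elim⟩
    · obtain ⟨p, hp⟩ := Finite.exists_min c
      exact ⟨c p, hc0 p, hp⟩
  refine ⟨b, c', max c' (∑ p, |C p|), hc'0, le_max_left _ _, hLS, hbii, ?_⟩
  intro i j hij s hs
  have ha := (hW i j hij).2.1 s (hT00.trans hs)
  have h1 := hhd i j s hs
  have hs' : T0 ≤ s := hs
  have hmem : (x (s - h i j s) j, x s i) ∈ Metric.closedBall (0 : Fin m → ℝ) (∑ k, |M k|) ×ˢ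
      Metric.closedBall (0 : Fin m → ℝ) (∑ k, |M k|) :=
    ⟨hMb j _ (by linarith), hMb i s (by linarith)⟩
  rw [hbij i j hij s hs, mul_comm (a i j s)]
  constructor
  · exact mul_le_mul_of_nonneg_right ((hc' (i, j)).trans (hc (i, j) _ hmem)) ha
  · refine mul_le_mul_of_nonneg_right ?_ ha
    refine (hC (i, j) _ hmem).trans ((le_abs_self _).trans (le_trans ?_ (le_max_right _ _)))
    exact Finset.single_le_sum (f := fun p => |C p|) (fun _ _ => abs_nonneg _) (Finset.mem_univ (i, j))

lemma b_cmp {a b h : V → V → ℝ → ℝ} {hbar T0 : ℝ} {x : V → ℝ → ℝ} {c C : ℝ}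
    (hW : Weights a) (H : LS b h hbar T0 x) (hT0 : 0 ≤ T0) {i j : V} (hij : i ≠ j)
    (hba : ∀ s ≥ T0, c * a i j s ≤ b i j s ∧ b i j s ≤ C * a i j s) {s t : ℝ} (hs : T0 ≤ s)
    (ht : s ≤ t) : c * ∫ r in s..t, a i j r ≤ ∫ r in s..t, b i j r ∧
      ∫ r in s..t, b i j r ≤ C * ∫ r in s..t, a i j r := by
  have hi : IntervalIntegrable (a i j) volume s t := hW.ii hij (by linarith) (by linarith)
  rw [← intervalIntegral.integral_const_mul, ← intervalIntegral.integral_const_mul]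
  exact ⟨intervalIntegral.integral_mono_on ht (hi.const_mul c) (H.bint i j _ _) fun r hr =>
    (hba r (hs.trans hr.1)).1, intervalIntegral.integral_mono_on ht (H.bint i j _ _)
    (hi.const_mul C) fun r hr => (hba r (hs.trans hr.1)).2⟩

lemma aux_parc {a : V → V → ℝ → ℝ} (hW : Weights a) {u v : V} (hP : PArc a u v) {tq : ℕ → ℝ}
    (h0 : 0 ≤ tq 0) (hm : Monotone tq) (hl : Tendsto tq atTop atTop)
    (hS : Summable fun p => ∫ s in (tq p)..(tq (p+1)), a v u s) : False := by
  obtain ⟨hne, htop⟩ := hP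
  have hvu : v ≠ u := hne.symm
  have hpos : ∀ n, 0 ≤ tq n := fun n => h0.trans (hm (Nat.zero_le n))
  have hIoi : IntegrableOn (a v u) (Ioi 0) := by
    refine integrableOn_Ioi_of_intervalIntegral_norm_bounded
      ((∫ s in (0:ℝ)..(tq 0), a v u s) + ∑' p, ∫ s in (tq p)..(tq (p+1)), a v u s) 0
      (l := atTop) (b := tq) (fun n => ?_) hl (Eventually.of_forall fun n => ?_)
    · exact ((hW v u hvu).2.2 (tq n)).mono_set Ioc_subset_Icc_self
    · have e1 : ∫ s in (0:ℝ)..(tq n), ‖a v u s‖ = ∫ s in (0:ℝ)..(tq n), a v u s := by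
        refine intervalIntegral.integral_congr fun s hs => ?_
        rw [uIcc_of_le (hpos n)] at hs
        exact Real.norm_of_nonneg ((hW v u hvu).2.1 s hs.1)
      rw [e1, ← intervalIntegral.integral_add_adjacent_intervals
        (hW.ii hvu le_rfl (hpos 0)) (hW.ii hvu (hpos 0) (hpos n)),
        ← intervalIntegral.sum_integral_adjacent_intervals
          (fun k _ => hW.ii hvu (hpos k) (hpos (k+1)))]
      gcongr
      exact hS.sum_le_tsum _ fun p _ => hW.wnn hvu (hpos p) (hm (Nat.le_succ p))
  exact (Integrable.lintegral_lt_top hIoi).ne htop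

lemma main_aqsc (m : ℕ) (a : V → V → ℝ → ℝ) (hW : Weights a) (hU : ULI a)
    (ψ : V → V → (Fin m → ℝ) → (Fin m → ℝ) → ℝ)
    (hψc : ∀ i j : V, Continuous (fun p : (Fin m → ℝ) × (Fin m → ℝ) => ψ i j p.1 p.2))
    (hψb : ∀ i j : V, ∀ Ω : Set ((Fin m → ℝ) × (Fin m → ℝ)), IsCompact Ω →
      (∃ c > (0:ℝ), ∀ p ∈ Ω, c ≤ ψ i j p.1 p.2) ∧ (∃ C : ℝ, ∀ p ∈ Ω, ψ i j p.1 p.2 ≤ C))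
    (hA : AQSC a) {hbar : ℝ} (hb0 : 0 ≤ hbar) {h : V → V → ℝ → ℝ} (hd : Delays h hbar)
    {tstar : ℝ} (hts : 0 ≤ tstar) {x : ℝ → V → (Fin m → ℝ)} (hx : IsSolN m a h ψ hbar tstar x) :
    ∃ c : Fin m → ℝ, ∀ i : V, Tendsto (fun t => x t i) atTop (𝓝 c) := by
  obtain ⟨ε, hε, tp, hI, hbd, hQ⟩ := hA
  obtain ⟨b, c, C, hc, hcC, hLS, hbii, hba⟩ := reduction hW hψc hψb hb0 hd hts hx
  have hT0 : 0 ≤ tstar + hbar := by linarith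
  obtain ⟨q, L, hq, hq0, hqs, hqL⟩ := grouping hW hU hI hbd hb0 (tstar + hbar)
  have hk : ∀ k : Fin m, ∃ c : ℝ, ∀ i, Tendsto (fun t => x t i k) atTop (𝓝 c) := by
    intro k
    have H := hLS k
    have hB := blk_transfer hW H hT0 (hc.le.trans hcC) hbii (fun i j hij s hs => (hba i j hij s hs).2)
      (tq := fun r => tp (q r)) hq0 hqs (hI.2.1.comp hq.tendsto_atTop) hqL
    refine H.aqsc hB (mul_pos hc hε) fun r => ?_
    obtain ⟨ρ, hρ⟩ := hQ (q r)
    refine ⟨ρ, fun i => aux_rtg ?_ (hρ i)⟩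
    intro u v huv hle
    have hr := hB.le0 r
    have hr1 : tp (q r) ≤ tp (q (r+1)) := hB.mono (Nat.le_succ r)
    have h1 := (b_cmp hW H hT0 huv.symm (hba v u huv.symm) hr hr1).1
    refine le_trans ?_ h1
    refine mul_le_mul_of_nonneg_left (hle.trans ?_) hc.le
    exact hW.mono huv.symm (hT0.trans hr) le_rfl (hI.1.monotone (Nat.le_succ _))
      (hI.1.monotone (hq (Nat.lt_succ_self r)))
  choose cc hcc using hk
  exact ⟨cc, fun i => tendsto_pi_nhds.2 fun k => hcc k i⟩

lemma main_nits (m : ℕ) (a : V → V → ℝ → ℝ) (hW : Weights a) (hU : ULI a)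
    (ψ : V → V → (Fin m → ℝ) → (Fin m → ℝ) → ℝ)
    (hψc : ∀ i j : V, Continuous (fun p : (Fin m → ℝ) × (Fin m → ℝ) => ψ i j p.1 p.2))
    (hψb : ∀ i j : V, ∀ Ω : Set ((Fin m → ℝ) × (Fin m → ℝ)), IsCompact Ω →
      (∃ c > (0:ℝ), ∀ p ∈ Ω, c ≤ ψ i j p.1 p.2) ∧ (∃ C : ℝ, ∀ p ∈ Ω, ψ i j p.1 p.2 ≤ C))
    (hA : NITS a) {hbar : ℝ} (hb0 : 0 ≤ hbar) {h : V → V → ℝ → ℝ} (hd : Delays h hbar)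
    {tstar : ℝ} (hts : 0 ≤ tstar) {x : ℝ → V → (Fin m → ℝ)} (hx : IsSolN m a h ψ hbar tstar x) :
    ∃ ℓ : V → Fin m → ℝ, (∀ i, Tendsto (fun t => x t i) atTop (𝓝 (ℓ i))) ∧
      ∀ u v, PArc a u v → ℓ u = ℓ v := by
  obtain ⟨K, hK1, tp, hI, hbd, hK⟩ := hA
  obtain ⟨b, c, C, hc, hcC, hLS, hbii, hba⟩ := reduction hW hψc hψb hb0 hd hts hx
  have hT0 : 0 ≤ tstar + hbar := by linarith
  have hC0 : 0 < C := hc.trans_le hcC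
  obtain ⟨q, L, hq, hq0, hqs, hqL⟩ := grouping hW hU hI hbd hb0 (tstar + hbar)
  have hBk : ∀ k : Fin m, Blk b hbar (tstar + hbar) (fun r => tp (q r))
      (Fintype.card V * (Fintype.card V * |C * L|)) := fun k =>
    blk_transfer hW (hLS k) hT0 hC0.le hbii (fun i j hij s hs => (hba i j hij s hs).2)
      hq0 hqs (hI.2.1.comp hq.tendsto_atTop) hqL
  have hK' : 1 ≤ C * K / c := by
    rw [le_div_iff₀ hc]
    nlinarith
  have hKb : ∀ _k : Fin m, ∀ p i j, i ≠ j → ∫ r in (tp (q p))..(tp (q (p+1))), b i j r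
      ≤ C * K / c * ∫ r in (tp (q p))..(tp (q (p+1))), b j i r := by
    intro k p i j hij
    have hr := (hBk k).le0 p
    have hr1 : tp (q p) ≤ tp (q (p+1)) := (hBk k).mono (Nat.le_succ p)
    have h1 := (b_cmp hW (hLS k) hT0 hij (hba i j hij) hr hr1).2
    have h2 := (b_cmp hW (hLS k) hT0 hij.symm (hba j i hij.symm) hr hr1).1
    have h3 := nits_group hW hI hij (fun p => (hK p i j).2) (hq (Nat.lt_succ_self p)).le
    calc _ ≤ _ := h1
      _ ≤ C * (K * ∫ r in (tp (q p))..(tp (q (p+1))), a j i r) :=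
        mul_le_mul_of_nonneg_left h3 hC0.le
      _ = C * K / c * (c * ∫ r in (tp (q p))..(tp (q (p+1))), a j i r) := by field_simp
      _ ≤ _ := mul_le_mul_of_nonneg_left h2 (by linarith)
  choose ℓ hℓ using fun (i : V) (k : Fin m) => (hLS k).nits (hBk k) hK' (hKb k) i
  refine ⟨ℓ, fun i => tendsto_pi_nhds.2 fun k => hℓ i k, ?_⟩
  intro u v hP
  funext k
  by_contra hne
  have hvu : v ≠ u := hP.1.symm
  have hwn : ∀ p i j, 0 ≤ ∫ r in (tp (q p))..(tp (q (p+1))), b i j r := fun p i j =>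
    (hLS k).wnn ((hBk k).mono (Nat.le_succ p)) i j
  have hS : Summable fun p => ∫ r in (tp (q p))..(tp (q (p+1))), b v u r := by
    rcases lt_or_gt_of_ne hne with hlt | hlt
    · exact (hLS k).nits_sum (hBk k) hK' (hKb k) (hℓ u k) (hℓ v k) hlt
    · have h1 := (hLS k).nits_sum (hBk k) hK' (hKb k) (hℓ v k) (hℓ u k) hlt
      exact Summable.of_nonneg_of_le (fun p => hwn p v u) (fun p => hKb k p v u hvu)
        (h1.mul_left _)
  have hpos : ∀ p, 0 ≤ tp (q p) := fun p => hT0.trans ((hBk k).le0 p)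
  refine aux_parc hW hP (tq := fun p => tp (q p)) (hpos 0) (hBk k).mono (hBk k).lim ?_
  refine Summable.of_nonneg_of_le (fun p => hW.wnn hvu (hpos p) ((hBk k).mono (Nat.le_succ p)))
    (fun p => ?_) (hS.mul_left (1/c))
  have h1 := (b_cmp hW (hLS k) hT0 hvu (hba v u hvu) ((hBk k).le0 p)
    ((hBk k).mono (Nat.le_succ p))).1
  rw [one_div, ← div_eq_inv_mul, le_div_iff₀ hc, mul_comm]
  exact h1

theorem stmt10
    (m : ℕ) (a : V → V → ℝ → ℝ) (hW : Weights a) (hU : ULI a)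
    (ψ : V → V → (Fin m → ℝ) → (Fin m → ℝ) → ℝ)
    (hψc : ∀ i j : V, Continuous (fun p : (Fin m → ℝ) × (Fin m → ℝ) => ψ i j p.1 p.2))
    (hψb : ∀ i j : V, ∀ Ω : Set ((Fin m → ℝ) × (Fin m → ℝ)), IsCompact Ω →
      (∃ c > (0:ℝ), ∀ p ∈ Ω, c ≤ ψ i j p.1 p.2) ∧ (∃ C : ℝ, ∀ p ∈ Ω, ψ i j p.1 p.2 ≤ C)) :
    (AQSC a → ∀ hbar ≥ (0:ℝ), ∀ h : V → V → ℝ → ℝ, Delays h hbar →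
      ∀ tstar ≥ (0:ℝ), ∀ x : ℝ → V → (Fin m → ℝ), IsSolN m a h ψ hbar tstar x →
        ∃ c : Fin m → ℝ, ∀ i : V, Tendsto (fun t => x t i) atTop (𝓝 c)) ∧
    (NITS a → ∀ hbar ≥ (0:ℝ), ∀ h : V → V → ℝ → ℝ, Delays h hbar →
      ∀ tstar ≥ (0:ℝ), ∀ x : ℝ → V → (Fin m → ℝ), IsSolN m a h ψ hbar tstar x →
        (∀ i : V, ∃ ci : Fin m → ℝ, Tendsto (fun t => x t i) atTop (𝓝 ci)) ∧
        (∀ i j : V, JoinedG a i j →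
          ∃ c : Fin m → ℝ, Tendsto (fun t => x t i) atTop (𝓝 c) ∧
            Tendsto (fun t => x t j) atTop (𝓝 c))) := by
  refine ⟨fun hA hbar hb0 h hd tstar hts x hx =>
    main_aqsc m a hW hU ψ hψc hψb hA hb0 hd hts hx, fun hA hbar hb0 h hd tstar hts x hx => ?_⟩
  obtain ⟨ℓ, hℓ, hP⟩ := main_nits m a hW hU ψ hψc hψb hA hb0 hd hts hx
  refine ⟨fun i => ⟨ℓ i, hℓ i⟩, fun i j hij => ⟨ℓ i, hℓ i, ?_⟩⟩
  have heq : ℓ i = ℓ j := by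
    induction hij with
    | refl => rfl
    | tail _ hr ih => exact ih.trans (hP _ _ hr)
  rw [heq]
  exact hℓ j
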